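/- arXiv:2206.09342 — 8 statements merged into one kernel-verified Lean document; each statement's English description precedes it below -/
import Mathlib

section
/- Let κ > 0, r > 0, m ≥ 2, and let i, j be real numbers with j > 0 and i > j/m. Then as ε → 0⁺, ε^{i − j/m} · ∫₀^{r²} t^{j/2 − 1} (ε + 2κ t^{m/2})^{−i} dt converges to (2/(m(2κ)^{j/m})) · Γ(j/m)·Γ(i − j/m)/Γ(i), where Γ denotes the Gamma function Γ(s) = ∫₀^∞ x^{s−1}e^{−x} dx. -/
open MeasureTheory Set Filter Topology

/-- The integrand of the Beta function on `(0, 1)` is integrable. -/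
theorem integrableOn_beta_Ioo {a b : ℝ} (ha : 0 < a) (hb : 0 < b) :
    IntegrableOn (fun x : ℝ => x ^ (a - 1) * (1 - x) ^ (b - 1)) (Ioo 0 1) := by
  have h := Complex.betaIntegral_convergent (u := a) (v := b) (by simpa) (by simpa)
  rw [intervalIntegrable_iff_integrableOn_Ioo_of_le zero_le_one] at h
  refine IntegrableOn.congr_fun h.re (fun x hx => ?_) measurableSet_Ioo
  have h1 : (x : ℂ) ^ ((a : ℂ) - 1) = ((x ^ (a - 1) : ℝ) : ℂ) := by
    rw [Complex.ofReal_cpow hx.1.le]; push_cast; rfl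
  have h2 : (1 - (x : ℂ)) ^ ((b : ℂ) - 1) = (((1 - x) ^ (b - 1) : ℝ) : ℂ) := by
    rw [Complex.ofReal_cpow (by linarith [hx.2])]; push_cast; rfl
  simp only [h1, h2, ← Complex.ofReal_mul]
  rfl

/-- The Beta integral over `(0, 1)` in terms of the Gamma function. -/
theorem integral_beta_Ioo {a b : ℝ} (ha : 0 < a) (hb : 0 < b) :
    ∫ x in Ioo (0 : ℝ) 1, x ^ (a - 1) * (1 - x) ^ (b - 1) =
      Real.Gamma a * Real.Gamma b / Real.Gamma (a + b) := by
  have h := ProbabilityTheory.beta_eq_betaIntegralReal a b ha hb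
  rw [ProbabilityTheory.beta] at h
  rw [h, Complex.betaIntegral, intervalIntegral.integral_of_le zero_le_one,
    integral_Ioc_eq_integral_Ioo]
  have : ∀ x ∈ Ioo (0 : ℝ) 1, (x : ℂ) ^ ((a : ℂ) - 1) * (1 - (x : ℂ)) ^ ((b : ℂ) - 1) =
      ((x ^ (a - 1) * (1 - x) ^ (b - 1) : ℝ) : ℂ) := by
    intro x hx
    rw [Complex.ofReal_mul, Complex.ofReal_cpow hx.1.le,
      Complex.ofReal_cpow (by linarith [hx.2])]
    push_cast; rfl
  rw [setIntegral_congr_fun measurableSet_Ioo this, integral_complex_ofReal, Complex.ofReal_re]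

theorem image_div_one_add_Ioi :
    (fun s : ℝ => s / (1 + s)) '' Ioi 0 = Ioo 0 1 := by
  ext x
  constructor
  · rintro ⟨s, hs, rfl⟩
    have hs : 0 < s := hs
    exact ⟨by positivity, by rw [div_lt_one (by positivity)]; linarith⟩
  · rintro ⟨h0, h1⟩
    have : 0 < 1 - x := by linarith
    refine ⟨x / (1 - x), div_pos h0 this, ?_⟩
    have h2 : 1 + x / (1 - x) = 1 / (1 - x) := by field_simp; ring
    simp only [h2]
    field_simp

theorem injOn_div_one_add : InjOn (fun s : ℝ => s / (1 + s)) (Ioi 0) := by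
  intro s hs t ht h
  have hs : 0 < s := hs
  have ht : 0 < t := ht
  have h : s / (1 + s) = t / (1 + t) := h
  rw [div_eq_div_iff (by positivity) (by positivity)] at h
  linarith

theorem hasDerivAt_div_one_add {s : ℝ} (hs : 0 < s) :
    HasDerivAt (fun s : ℝ => s / (1 + s)) (1 / (1 + s) ^ 2) s := by
  have h := (hasDerivAt_id s).div ((hasDerivAt_id s).const_add 1)
    (by simp only [id]; positivity)
  refine h.congr_deriv ?_
  simp

theorem abs_deriv_smul_beta_comp_div_one_add (a b : ℝ) {s : ℝ} (hs : 0 < s) :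
    |1 / (1 + s) ^ 2| • ((s / (1 + s)) ^ (a - 1) * (1 - s / (1 + s)) ^ (b - 1)) =
      s ^ (a - 1) * (1 + s) ^ (-(a + b)) := by
  have h1 : 0 < 1 + s := by positivity
  have h2 : 1 - s / (1 + s) = (1 + s)⁻¹ := by field_simp; ring
  rw [h2, abs_of_pos (by positivity), smul_eq_mul, Real.div_rpow hs.le h1.le,
    Real.inv_rpow h1.le, ← Real.rpow_neg h1.le, div_eq_mul_inv (s ^ (a - 1)),
    ← Real.rpow_neg h1.le, one_div, ← Real.rpow_natCast, ← Real.rpow_neg h1.le,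
    show -(a + b) = -((2 : ℕ) : ℝ) + (-(a - 1) + -(b - 1)) by push_cast; ring,
    Real.rpow_add h1, Real.rpow_add h1]
  ring

/-- The integrand of the Beta function on the half-line is integrable. -/
theorem integrableOn_beta_Ioi {a b : ℝ} (ha : 0 < a) (hb : 0 < b) :
    IntegrableOn (fun s : ℝ => s ^ (a - 1) * (1 + s) ^ (-(a + b))) (Ioi 0) := by
  have h := integrableOn_beta_Ioo ha hb
  rw [← image_div_one_add_Ioi, integrableOn_image_iff_integrableOn_abs_deriv_smul
    measurableSet_Ioi (fun s hs => (hasDerivAt_div_one_add hs).hasDerivWithinAt)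
    injOn_div_one_add] at h
  exact h.congr_fun (fun s hs => abs_deriv_smul_beta_comp_div_one_add a b hs) measurableSet_Ioi

/-- The Beta integral over the half-line in terms of the Gamma function. -/
theorem integral_beta_Ioi {a b : ℝ} (ha : 0 < a) (hb : 0 < b) :
    ∫ s in Ioi (0 : ℝ), s ^ (a - 1) * (1 + s) ^ (-(a + b)) =
      Real.Gamma a * Real.Gamma b / Real.Gamma (a + b) := by
  rw [← integral_beta_Ioo ha hb, ← image_div_one_add_Ioi,
    integral_image_eq_integral_abs_deriv_smul
      measurableSet_Ioi (fun s hs => (hasDerivAt_div_one_add hs).hasDerivWithinAt)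
      injOn_div_one_add]
  exact setIntegral_congr_fun measurableSet_Ioi
    fun s hs => (abs_deriv_smul_beta_comp_div_one_add a b hs).symm

/-- The substitution `s = c * t ^ p` in an interval integral, with no regularity assumption. -/
theorem integral_const_mul_rpow_substitution {c p T : ℝ} (hc : 0 < c) (hp : 0 < p) (hT : 0 ≤ T)
    (f : ℝ → ℝ) :
    ∫ s in (0 : ℝ)..(c * T ^ p), f s =
      ∫ t in (0 : ℝ)..T, c * (p * t ^ (p - 1)) * f (c * t ^ p) := by
  have himage : (fun t : ℝ => c * t ^ p) '' Ioc 0 T = Ioc 0 (c * T ^ p) := by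
    ext x
    constructor
    · rintro ⟨t, ⟨h0, h1⟩, rfl⟩
      exact ⟨by positivity, by dsimp only; gcongr⟩
    · rintro ⟨h0, h1⟩
      have hx : 0 < x / c := by positivity
      refine ⟨(x / c) ^ p⁻¹, ⟨by positivity, ?_⟩, ?_⟩
      · rw [Real.rpow_inv_le_iff_of_pos hx.le hT hp, div_le_iff₀ hc]
        linarith
      · simp only [Real.rpow_inv_rpow hx.le hp.ne']
        field_simp
  have hinj : InjOn (fun t : ℝ => c * t ^ p) (Ioc 0 T) := fun s hs t ht h =>
    (Real.rpow_left_inj hs.1.le ht.1.le hp.ne').1 (mul_left_cancel₀ hc.ne' h)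
  rw [intervalIntegral.integral_of_le (by positivity), intervalIntegral.integral_of_le hT,
    ← himage, integral_image_eq_integral_abs_deriv_smul (f' := fun t => c * (p * t ^ (p - 1)))
      measurableSet_Ioc
      (fun t ht => ((Real.hasDerivAt_rpow_const (Or.inl ht.1.ne')).const_mul c).hasDerivWithinAt)
      hinj]
  refine setIntegral_congr_fun measurableSet_Ioc fun t ht => ?_
  have := ht.1
  rw [abs_of_pos (by positivity), smul_eq_mul]

/-- Rescaling turns the gap integral into a truncated Beta integral. -/
theorem rpow_mul_gap_integral_eq {κ m i j ε T : ℝ} (hκ : 0 < κ) (hm : 0 < m) (hε : 0 < ε)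
    (hT : 0 ≤ T) :
    ε ^ (i - j / m) *
        ∫ t in (0 : ℝ)..T, t ^ (j / 2 - 1) * (ε + 2 * κ * t ^ (m / 2)) ^ (-i) =
      2 / (m * (2 * κ) ^ (j / m)) *
        ∫ s in (0 : ℝ)..(2 * κ / ε * T ^ (m / 2)), s ^ (j / m - 1) * (1 + s) ^ (-i) := by
  rw [integral_const_mul_rpow_substitution (by positivity) (by positivity) hT,
    ← intervalIntegral.integral_const_mul, ← intervalIntegral.integral_const_mul,
    intervalIntegral.integral_of_le hT, intervalIntegral.integral_of_le hT]
  refine setIntegral_congr_fun measurableSet_Ioc fun t ht => ?_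
  have ht : 0 < t := ht.1
  have h1 : ε + 2 * κ * t ^ (m / 2) = ε * (1 + 2 * κ / ε * t ^ (m / 2)) := by field_simp
  have h2 : t ^ (j / 2 - 1) = t ^ (m / 2 - 1) * (t ^ (m / 2)) ^ (j / m - 1) := by
    rw [← Real.rpow_mul ht.le, ← Real.rpow_add ht]
    congr 1
    field_simp
    ring
  have h3 : (2 * κ / ε) ^ (j / m - 1) = (2 * κ) ^ (j / m) / ε ^ (j / m) / (2 * κ / ε) := by
    rw [Real.rpow_sub_one (by positivity), Real.div_rpow (by positivity) hε.le]
  rw [h1, h2, Real.mul_rpow hε.le (by positivity),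
    Real.mul_rpow (x := 2 * κ / ε) (by positivity) (by positivity), h3, Real.rpow_sub hε,
    Real.rpow_neg hε.le]
  have h4 : 0 < ε ^ i := by positivity
  have h5 : 0 < ε ^ (j / m) := by positivity
  have h6 : 0 < (2 * κ) ^ (j / m) := by positivity
  generalize ε ^ i = x at *
  generalize ε ^ (j / m) = y at *
  generalize (2 * κ) ^ (j / m) = z at *
  generalize (1 + 2 * κ / ε * t ^ (m / 2)) ^ (-i) = w at *
  field_simp

/-- Asymptotics of the gap integral in the non-borderline case `i > j/m`:
`ε^{i−j/m} ∫₀^{r²} t^{j/2−1}(ε+2κt^{m/2})^{−i} dt → (2/(m(2κ)^{j/m}))·Γ(j/m)Γ(i−j/m)/Γ(i)`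
as `ε → 0⁺`. -/
theorem stmt2 (κ r m i j : ℝ) (hκ : 0 < κ) (hr : 0 < r) (hm : 2 ≤ m)
    (hj : 0 < j) (hi : j / m < i) :
    Filter.Tendsto
      (fun ε : ℝ => ε ^ (i - j / m) *
        ∫ t in (0 : ℝ)..(r ^ 2), t ^ (j / 2 - 1) * (ε + 2 * κ * t ^ (m / 2)) ^ (-i))
      (nhdsWithin 0 (Set.Ioi 0))
      (nhds (2 / (m * (2 * κ) ^ (j / m)) *
        (Real.Gamma (j / m) * Real.Gamma (i - j / m) / Real.Gamma i))) := by
  have hm0 : 0 < m := by linarith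
  have ha : 0 < j / m := div_pos hj hm0
  have hb : 0 < i - j / m := sub_pos.2 hi
  have hab : j / m + (i - j / m) = i := by ring
  have hint := integrableOn_beta_Ioi ha hb
  have hval := integral_beta_Ioi ha hb
  rw [hab] at hint hval
  have hR : Tendsto (fun ε : ℝ => 2 * κ / ε * (r ^ 2) ^ (m / 2)) (𝓝[>] 0) atTop := by
    simp only [div_eq_mul_inv (2 * κ)]
    exact (tendsto_inv_nhdsGT_zero.const_mul_atTop (by positivity)).atTop_mul_const (by positivity)
  have hlim := (intervalIntegral_tendsto_integral_Ioi 0 hint hR).const_mul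
    (2 / (m * (2 * κ) ^ (j / m)))
  rw [hval] at hlim
  refine hlim.congr' ?_
  filter_upwards [self_mem_nhdsWithin] with ε hε
  exact (rpow_mul_gap_integral_eq hκ hm0 hε (by positivity)).symm
end

section
/- Fix ε > 0, κ > 0, r > 0, m ≥ 2 and c ∈ ℝ. On {x = (x1,x2,x3) ∈ ℝ³ : (x1,x2) ≠ (0,0)} define δ(x') = ε + 2κ|x'|^m, G(x) = x3/δ(x'), ∂₁δ(x') = 2κm|x'|^{m−2}x1, and the vector field v(x) = c(1/2 + G(x))e₁ + c(G(x)² − 1/4)(∂₁δ(x')/2)e₃. Then div v(x) = 0 at every such point. -/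
/-- Gap width `δ(x') = ε + 2κ|x'|^m`. -/
noncomputable def δf (ε κ m x1 x2 : ℝ) : ℝ := ε + 2 * κ * Real.sqrt (x1 ^ 2 + x2 ^ 2) ^ m

/-- `∂₁δ(x') = 2κm|x'|^{m−2}x₁`. -/
noncomputable def d1δ (κ m x1 x2 : ℝ) : ℝ :=
  2 * κ * m * Real.sqrt (x1 ^ 2 + x2 ^ 2) ^ (m - 2) * x1

theorem δf_pos {ε κ : ℝ} (hε : 0 < ε) (hκ : 0 ≤ κ) (m x1 x2 : ℝ) : 0 < δf ε κ m x1 x2 := by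
  unfold δf
  positivity

theorem hasDerivAt_δf (ε κ m : ℝ) {x1 x2 : ℝ} (h : 0 < x1 ^ 2 + x2 ^ 2) :
    HasDerivAt (fun t => δf ε κ m t x2) (d1δ κ m x1 x2) x1 := by
  have hs : 0 < Real.sqrt (x1 ^ 2 + x2 ^ 2) := Real.sqrt_pos.mpr h
  have hsq : HasDerivAt (fun t : ℝ => t ^ 2 + x2 ^ 2) (2 * x1) x1 := by
    simpa using (hasDerivAt_pow 2 x1).add_const (x2 ^ 2)
  have hpow := (hsq.sqrt h.ne').rpow_const (p := m) (Or.inl hs.ne')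
  have hrpow : Real.sqrt (x1 ^ 2 + x2 ^ 2) ^ (m - 1) =
      Real.sqrt (x1 ^ 2 + x2 ^ 2) ^ (m - 2) * Real.sqrt (x1 ^ 2 + x2 ^ 2) := by
    rw [← Real.rpow_add_one hs.ne']
    ring_nf
  refine ((hpow.const_mul (2 * κ)).const_add ε).congr_deriv ?_
  rw [hrpow, d1δ]
  field_simp

/-- The Keller-type approximate shear velocity
`v = c(1/2+G)e₁ + c(G²−1/4)(∂₁δ/2)e₃` with `G = x₃/δ` is exactly divergence free
away from `x' = 0`. -/
theorem stmt4 (ε κ r m c : ℝ) (hε : 0 < ε) (hκ : 0 < κ) (hr : 0 < r) (hm : 2 ≤ m) :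
    ∀ x1 x2 x3 : ℝ, (x1, x2) ≠ (0, 0) →
      deriv (fun t => c * (1 / 2 + x3 / δf ε κ m t x2)) x1
        + deriv (fun _ : ℝ => (0 : ℝ)) x2
        + deriv (fun t => c * ((t / δf ε κ m x1 x2) ^ 2 - 1 / 4)
            * (d1δ κ m x1 x2 / 2)) x3
      = 0 := by
  intro x1 x2 x3 hx
  have hpos : 0 < x1 ^ 2 + x2 ^ 2 := by
    by_contra! hle
    apply hx
    ext <;> nlinarith [sq_nonneg x1, sq_nonneg x2]
  have hδ := (δf_pos hε hκ.le m x1 x2).ne'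
  have hv1 := ((((hasDerivAt_const x1 x3).div (hasDerivAt_δf ε κ m hpos) hδ).const_add
    (1 / 2)).const_mul c).deriv
  have hv3 := ((((((hasDerivAt_id x3).div_const (δf ε κ m x1 x2)).pow 2).sub_const
    (1 / 4)).const_mul c).mul_const (d1δ κ m x1 x2 / 2)).deriv
  simp only [Pi.div_apply, Pi.pow_apply, id, Nat.reduceSub, pow_one, Nat.cast_ofNat] at hv1 hv3
  rw [hv1, hv3, deriv_const]
  field_simp
  ring
end

section
/- Fix ε > 0, κ > 0, take m = 2 (so δ(x') = ε + 2κ|x'|²), fix ω1, ω2 ∈ ℝ, and set b1 = −12/5, b2 = 3/(10κ), b4 = 3/(5κ). Let w(x') = ω1 x2 − ω2 x1, c₁ = ω2, c₂ = −ω1. Then for every x' ∈ ℝ² and i ∈ {1,2}: 2μ δ(x')^{−2}(−b1 xᵢ w(x')/δ(x') + b2 cᵢ) + μ b4 ∂ᵢ(w(x') δ(x')^{−2}) = 0, for any μ > 0. -/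
/-- Gap width for `m = 2`: `δ(x') = ε + 2κ|x'|²`. -/
noncomputable def δ2 (ε κ x1 x2 : ℝ) : ℝ := ε + 2 * κ * (x1 ^ 2 + x2 ^ 2)

theorem δ2_pos {ε κ : ℝ} (hε : 0 < ε) (hκ : 0 < κ) (x1 x2 : ℝ) : 0 < δ2 ε κ x1 x2 := by
  unfold δ2
  positivity

theorem δ2_comm (ε κ x1 x2 : ℝ) : δ2 ε κ x1 x2 = δ2 ε κ x2 x1 := by
  unfold δ2
  ring

theorem hasDerivAt_δ2 (ε κ x1 x2 : ℝ) :
    HasDerivAt (fun t => δ2 ε κ t x2) (4 * κ * x1) x1 := by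
  unfold δ2
  refine (((((hasDerivAt_id' x1).fun_pow 2).add_const (x2 ^ 2)).const_mul (2 * κ)).const_add
    ε).congr_deriv ?_
  norm_num
  ring

/-- The derivative of an affine function divided by the square of the gap width. -/
theorem deriv_affine_div_δ2_sq {ε κ : ℝ} (hε : 0 < ε) (hκ : 0 < κ) (a b x1 x2 : ℝ) :
    deriv (fun t => (a + b * t) / δ2 ε κ t x2 ^ 2) x1 =
      b / δ2 ε κ x1 x2 ^ 2 - 8 * κ * x1 * (a + b * x1) / δ2 ε κ x1 x2 ^ 3 := by
  have hδ := (δ2_pos hε hκ x1 x2).ne'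
  have hnum : HasDerivAt (fun t => a + b * t) b x1 := by
    simpa using ((hasDerivAt_id x1).const_mul b).const_add a
  refine (hnum.fun_div ((hasDerivAt_δ2 ε κ x1 x2).fun_pow 2) (pow_ne_zero 2 hδ)).deriv.trans ?_
  field_simp
  ring

/-- Cancellation identity determining `b4`: with `w = ω1x₂ − ω2x₁`, `c₁ = ω2`,
`c₂ = −ω1`, `b1 = −12/5`, `b2 = 3/(10κ)`, `b4 = 3/(5κ)`, one has for `i = 1,2`
`2μδ^{−2}(−b1xᵢw/δ + b2cᵢ) + μb4 ∂ᵢ(wδ^{−2}) = 0` for any `μ > 0`. -/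
theorem stmt7 (ε κ ω1 ω2 b1 b2 b4 : ℝ) (hε : 0 < ε) (hκ : 0 < κ)
    (hb1 : b1 = -12 / 5) (hb2 : b2 = 3 / (10 * κ)) (hb4 : b4 = 3 / (5 * κ)) :
    ∀ μ > (0 : ℝ), ∀ x1 x2 : ℝ,
      (2 * μ / (δ2 ε κ x1 x2) ^ 2 *
          (-b1 * x1 * (ω1 * x2 - ω2 * x1) / δ2 ε κ x1 x2 + b2 * ω2)
        + μ * b4 * deriv (fun t => (ω1 * x2 - ω2 * t) / (δ2 ε κ t x2) ^ 2) x1 = 0) ∧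
      (2 * μ / (δ2 ε κ x1 x2) ^ 2 *
          (-b1 * x2 * (ω1 * x2 - ω2 * x1) / δ2 ε κ x1 x2 + b2 * (-ω1))
        + μ * b4 * deriv (fun t => (ω1 * t - ω2 * x1) / (δ2 ε κ x1 t) ^ 2) x2 = 0) := by
  intro μ _ x1 x2
  have hδ := (δ2_pos hε hκ x1 x2).ne'
  have h₁ := deriv_affine_div_δ2_sq hε hκ (ω1 * x2) (-ω2) x1 x2
  have h₂ := deriv_affine_div_δ2_sq hε hκ (-(ω2 * x1)) ω1 x2 x1
  have e₁ : (fun t => (ω1 * x2 - ω2 * t) / δ2 ε κ t x2 ^ 2) =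
      fun t => (ω1 * x2 + -ω2 * t) / δ2 ε κ t x2 ^ 2 := by
    funext t
    ring
  have e₂ : (fun t => (ω1 * t - ω2 * x1) / δ2 ε κ x1 t ^ 2) =
      fun t => (-(ω2 * x1) + ω1 * t) / δ2 ε κ t x1 ^ 2 := by
    funext t
    rw [δ2_comm ε κ x1 t]
    ring
  rw [δ2_comm ε κ x2 x1] at h₂
  rw [e₁, e₂, h₁, h₂, hb1, hb2, hb4]
  constructor <;> field_simp <;> ring
end

section
/- Fix ε > 0, κ > 0, m ≥ 2, μ > 0 and c ∈ ℝ. On {x ∈ ℝ³ : x' ≠ 0} define δ(x') = ε + 2κ|x'|^m, G(x) = x3/δ(x'), ∂₁δ(x') = 2κm|x'|^{m−2}x1, the velocity ū⁽¹⁾(x) = c(1/2 + G)e₁ + c(G² − 1/4)(∂₁δ/2)e₃, and the pressure p̄⁽¹⁾(x) = μ c x3 ∂₁δ(x')/δ(x')². Then at every such point: μ ∂₃₃ū⁽¹⁾ᵢ(x) − ∂ᵢ p̄⁽¹⁾(x) = −μ c x3 ∂ᵢ(∂₁δ/δ²)(x') for i = 1, 2, and μ ∂₃₃ū⁽¹⁾₃(x)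 − ∂₃ p̄⁽¹⁾(x) = 0. -/
/-- For the explicit shear-motion pair
`ū⁽¹⁾ = c(1/2+G)e₁ + c(G²−1/4)(∂₁δ/2)e₃`, `p̄⁽¹⁾ = μcx₃∂₁δ/δ²`
(`G = x₃/δ`), one has away from `x' = 0`:
`μ∂₃₃ū⁽¹⁾ᵢ − ∂ᵢp̄⁽¹⁾ = −μcx₃∂ᵢ(∂₁δ/δ²)` for `i = 1,2` and
`μ∂₃₃ū⁽¹⁾₃ − ∂₃p̄⁽¹⁾ = 0`. -/
theorem stmt8 (ε κ m μ c : ℝ) (hε : 0 < ε) (hκ : 0 < κ) (hm : 2 ≤ m) (hμ : 0 < μ) :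
    ∀ x1 x2 x3 : ℝ, (x1, x2) ≠ (0, 0) →
      (μ * deriv (fun t => deriv (fun s => c * (1 / 2 + s / δf ε κ m x1 x2)) t) x3
          - deriv (fun t => μ * c * x3 * d1δ κ m t x2 / (δf ε κ m t x2) ^ 2) x1
        = -(μ * c * x3) * deriv (fun t => d1δ κ m t x2 / (δf ε κ m t x2) ^ 2) x1) ∧
      (μ * deriv (fun t => deriv (fun _ : ℝ => (0 : ℝ)) t) x3
          - deriv (fun t => μ * c * x3 * d1δ κ m x1 t / (δf ε κ m x1 t) ^ 2) x2
        = -(μ * c * x3) * deriv (fun t => d1δ κ m x1 t / (δf ε κ m x1 t) ^ 2) x2) ∧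
      (μ * deriv (fun t => deriv
            (fun s => c * ((s / δf ε κ m x1 x2) ^ 2 - 1 / 4) * (d1δ κ m x1 x2 / 2)) t) x3
          - deriv (fun t => μ * c * t * d1δ κ m x1 x2 / (δf ε κ m x1 x2) ^ 2) x3 = 0) := by
  intro x1 x2 x3 _
  have horizontal (f g : ℝ → ℝ) (x : ℝ) :
      deriv (fun t => μ * c * x3 * f t / g t ^ 2) x
        = μ * c * x3 * deriv (fun t => f t / g t ^ 2) x := by
    simp_rw [mul_div_assoc (μ * c * x3)]
    exact deriv_const_mul_field _
  refine ⟨?_, ?_, ?_⟩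
  · have affine (t : ℝ) : deriv (fun s => c * (1 / 2 + s / δf ε κ m x1 x2)) t
        = c * (1 / δf ε κ m x1 x2) :=
      ((((hasDerivAt_id t).div_const _).const_add _).const_mul c).deriv
    simp only [affine, deriv_const, horizontal]
    ring
  · simp only [deriv_const, horizontal]
    ring
  · generalize δf ε κ m x1 x2 = d, d1δ κ m x1 x2 = e
    have first (t : ℝ) : deriv (fun s => c * ((s / d) ^ 2 - 1 / 4) * (e / 2)) t
        = c * e / d ^ 2 * t := by
      refine (((((hasDerivAt_id' t).div_const d).fun_pow 2).sub_const (1 / 4)).const_mul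
        c |>.mul_const (e / 2)).deriv.trans ?_
      push_cast
      ring
    have pressure : (fun t => μ * c * t * e / d ^ 2) = fun t => μ * c * e / d ^ 2 * t := by
      ext t
      ring
    have linear (a : ℝ) : deriv (fun t => a * t) x3 = a := by
      simp
    simp only [first, pressure, linear]
    ring
end

section
/- Let Ω' ⊆ ℝ³ be open, μ > 0, let u : Ω' → ℝ³ be C² with div u = 0 on Ω', let p : Ω' → ℝ be C¹, and suppose q₁, q₂, q₃ : Ω' → ℝ are C¹ functions satisfying ∂_k q_k = μ Δu_k − ∂_k p on Ω' for k = 1, 2, 3. Define the matrix field S by S_{kl} = μ(∂_l u_k + ∂_k u_l) for k ≠ l and S_{kk} = 2μ ∂_k u_k − p − q_k. Then S is symmetric and divergence-free on Ω', i.e. Σ_{l=1}^{3} ∂_l S_{kl} = 0 on Ω' for each k = 1, 2, 3. -/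
/-- Partial derivative `∂ᵢf(x) = Df(x)[eᵢ]` of a scalar function on `ℝ³`. -/
noncomputable def pd (f : (Fin 3 → ℝ) → ℝ) (i : Fin 3) (x : Fin 3 → ℝ) : ℝ :=
  fderiv ℝ f x (Pi.single i 1)

lemma differentiableAt_pd {f : (Fin 3 → ℝ) → ℝ} {x : Fin 3 → ℝ} (hf : ContDiffAt ℝ 2 f x)
    (i : Fin 3) : DifferentiableAt ℝ (pd f i) x :=
  ((hf.fderiv_right (m := 1) (by norm_num)).differentiableAt one_ne_zero).clm_apply
    (differentiableAt_const _)

lemma pd_pd_eq {f : (Fin 3 → ℝ) → ℝ} {x : Fin 3 → ℝ} (hf : ContDiffAt ℝ 2 f x) (i j : Fin 3) :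
    pd (pd f i) j x = fderiv ℝ (fderiv ℝ f) x (Pi.single j 1) (Pi.single i 1) := by
  have h : DifferentiableAt ℝ (fderiv ℝ f) x :=
    (hf.fderiv_right (m := 1) (by norm_num)).differentiableAt one_ne_zero
  change fderiv ℝ (fun y => fderiv ℝ f y (Pi.single i 1)) x (Pi.single j 1) = _
  rw [fderiv_clm_apply h (differentiableAt_const _)]
  simp

lemma pd_comm {f : (Fin 3 → ℝ) → ℝ} {x : Fin 3 → ℝ} (hf : ContDiffAt ℝ 2 f x) (i j : Fin 3) :
    pd (pd f i) j x = pd (pd f j) i x := by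
  rw [pd_pd_eq hf, pd_pd_eq hf]
  exact hf.isSymmSndFDerivAt (by simp) _ _

lemma pd_add {f g : (Fin 3 → ℝ) → ℝ} {x : Fin 3 → ℝ} (hf : DifferentiableAt ℝ f x)
    (hg : DifferentiableAt ℝ g x) (i : Fin 3) :
    pd (fun y => f y + g y) i x = pd f i x + pd g i x := by
  simp [pd, fderiv_fun_add hf hg]

lemma pd_sub {f g : (Fin 3 → ℝ) → ℝ} {x : Fin 3 → ℝ} (hf : DifferentiableAt ℝ f x)
    (hg : DifferentiableAt ℝ g x) (i : Fin 3) :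
    pd (fun y => f y - g y) i x = pd f i x - pd g i x := by
  simp [pd, fderiv_fun_sub hf hg]

lemma pd_const_mul {f : (Fin 3 → ℝ) → ℝ} {x : Fin 3 → ℝ} (hf : DifferentiableAt ℝ f x)
    (c : ℝ) (i : Fin 3) : pd (fun y => c * f y) i x = c * pd f i x := by
  simp [pd, fderiv_const_mul hf]

lemma pd_sum {f : Fin 3 → (Fin 3 → ℝ) → ℝ} {x : Fin 3 → ℝ}
    (hf : ∀ j, DifferentiableAt ℝ (f j) x) (i : Fin 3) :
    pd (fun y => ∑ j, f j y) i x = ∑ j, pd (f j) i x := by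
  simp [pd, fderiv_fun_sum (fun j _ => hf j)]

lemma pd_eq_zero_of_eqOn {f : (Fin 3 → ℝ) → ℝ} {s : Set (Fin 3 → ℝ)} (hs : IsOpen s)
    (hf : ∀ y ∈ s, f y = 0) {x : Fin 3 → ℝ} (hx : x ∈ s) (i : Fin 3) : pd f i x = 0 := by
  have h : f =ᶠ[nhds x] fun _ => 0 := Filter.eventually_of_mem (hs.mem_nhds hx) hf
  simp [pd, h.fderiv_eq]

/-- From any `C²` divergence-free velocity `u`, `C¹` pressure `p` and `C¹`
potentials `q₁,q₂,q₃` with `∂ₖqₖ = μΔuₖ − ∂ₖp` on an open set `Ω'`, the tensor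
`S_{kl} = μ(∂ₗuₖ + ∂ₖuₗ)` (`k ≠ l`), `S_{kk} = 2μ∂ₖuₖ − p − qₖ` is symmetric and
divergence free on `Ω'`. -/
theorem stmt12 (Ω' : Set (Fin 3 → ℝ)) (hΩ : IsOpen Ω') (μ : ℝ) (hμ : 0 < μ)
    (u : (Fin 3 → ℝ) → (Fin 3 → ℝ)) (hu : ContDiffOn ℝ 2 u Ω')
    (hdiv : ∀ x ∈ Ω', ∑ i : Fin 3, pd (fun y => u y i) i x = 0)
    (p : (Fin 3 → ℝ) → ℝ) (hp : ContDiffOn ℝ 1 p Ω')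
    (q : Fin 3 → (Fin 3 → ℝ) → ℝ) (hq : ∀ k, ContDiffOn ℝ 1 (q k) Ω')
    (hqk : ∀ k, ∀ x ∈ Ω', pd (q k) k x =
      μ * ∑ i : Fin 3, pd (pd (fun y => u y k) i) i x - pd p k x)
    (S : Fin 3 → Fin 3 → (Fin 3 → ℝ) → ℝ)
    (hS : ∀ k l x, S k l x =
      if k = l then 2 * μ * pd (fun y => u y k) k x - p x - q k x
      else μ * (pd (fun y => u y k) l x + pd (fun y => u y l) k x)) :
    ∀ x ∈ Ω', (∀ k l, S k l x = S l k x) ∧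
      ∀ k, ∑ l : Fin 3, pd (S k l) l x = 0 := by
  intro x hx
  have hux (k : Fin 3) : ContDiffAt ℝ 2 (fun y => u y k) x :=
    contDiffAt_pi.1 (hu.contDiffAt (hΩ.mem_nhds hx)) k
  have hpx : DifferentiableAt ℝ p x :=
    (hp.contDiffAt (hΩ.mem_nhds hx)).differentiableAt one_ne_zero
  have hqx (k : Fin 3) : DifferentiableAt ℝ (q k) x :=
    ((hq k).contDiffAt (hΩ.mem_nhds hx)).differentiableAt one_ne_zero
  have hd (k l : Fin 3) := differentiableAt_pd (hux k) l
  refine ⟨fun k l => ?_, fun k => ?_⟩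
  · rw [hS, hS]
    by_cases h : k = l
    · subst h; rfl
    · rw [if_neg h, if_neg (Ne.symm h), add_comm]
  have hpd (l : Fin 3) : pd (S k l) l x =
      μ * (pd (pd (fun y => u y k) l) l x + pd (pd (fun y => u y l) l) k x) -
        if k = l then pd p k x + pd (q k) k x else 0 := by
    by_cases h : k = l
    · subst h
      have hSk : S k k = fun y => 2 * μ * pd (fun y => u y k) k y - p y - q k y := by
        funext y; simp [hS]
      rw [hSk, pd_sub (((hd k k).const_mul _).fun_sub hpx) (hqx k),
        pd_sub ((hd k k).const_mul _) hpx, pd_const_mul (hd k k), if_pos rfl]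
      ring
    · have hSk : S k l =
          fun y => μ * (pd (fun y => u y k) l y + pd (fun y => u y l) k y) := by
        funext y; simp [hS, h]
      rw [hSk, pd_const_mul ((hd k l).fun_add (hd l k)), pd_add (hd k l) (hd l k), if_neg h,
        pd_comm (hux l) k l, sub_zero]
  have hgrad : ∑ l, pd (pd (fun y => u y l) l) k x = 0 := by
    rw [← pd_sum fun l => hd l l]
    exact pd_eq_zero_of_eqOn hΩ hdiv hx k
  simp_rw [hpd]
  rw [Finset.sum_sub_distrib, ← Finset.mul_sum, Finset.sum_add_distrib, hgrad,
    Finset.sum_ite_eq, if_pos (Finset.mem_univ k), hqk k x hx]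
  ring
end

section
/- Fix κ > 0, r > 0, m ≥ 2, μ > 0 and c ∈ ℝ. For ε ∈ (0,1) let Ω_r(ε) = {(x',x3) ∈ ℝ³ : |x3| < ε/2 + κ|x'|^m, |x'| < r}, δ(x') = ε + 2κ|x'|^m, G(x) = x3/δ(x'), ∂₁δ(x') = 2κm|x'|^{m−2}x1, ū⁽¹⁾(x) = c(1/2 + G)e₁ + c(G² − 1/4)(∂₁δ/2)e₃, and let S̄⁽¹⁾(x) be the symmetric matrix with S̄⁽¹⁾₁₃ = S̄⁽¹⁾₃₁ = μc/δ, S̄⁽¹⁾₃₃ = μc x3∂₁δ/δ², other entries zero. Define M(x) = e(ū⁽¹⁾)(x) − (1/(2μ))(S̄⁽¹⁾(x) − (tr S̄⁽¹⁾(x)/3)·Id₃), where e(v) = (∇v + (∇v)ᵀ)/2. Then there exists C > 0, independent of ε, such that for all ε ∈ (0,1): ∫_{Ω_r(ε)} tr(M(x)²) dx ≤ C. -/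
open Matrix MeasureTheory

/-- The approximate shear velocity `ū⁽¹⁾ = c(1/2+G)e₁ + c(G²−1/4)(∂₁δ/2)e₃`. -/
noncomputable def ubar1 (ε κ m c : ℝ) (x1 x2 x3 : ℝ) : Fin 3 → ℝ :=
  ![c * (1 / 2 + x3 / δf ε κ m x1 x2), 0,
    c * ((x3 / δf ε κ m x1 x2) ^ 2 - 1 / 4) * (d1δ κ m x1 x2 / 2)]

/-- Jacobian matrix `(∇v)_{kl} = ∂ₗvₖ`. -/
noncomputable def grad3 (v : ℝ → ℝ → ℝ → Fin 3 → ℝ) (x1 x2 x3 : ℝ) :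
    Matrix (Fin 3) (Fin 3) ℝ :=
  Matrix.of fun k l =>
    ![deriv (fun t => v t x2 x3 k) x1, deriv (fun t => v x1 t x3 k) x2,
      deriv (fun t => v x1 x2 t k) x3] l

/-- Rate of strain tensor `e(v) = (∇v + (∇v)ᵀ)/2`. -/
noncomputable def symGrad (v : ℝ → ℝ → ℝ → Fin 3 → ℝ) (x1 x2 x3 : ℝ) :
    Matrix (Fin 3) (Fin 3) ℝ :=
  (1 / 2 : ℝ) • (grad3 v x1 x2 x3 + (grad3 v x1 x2 x3)ᵀ)

/-- The shear test stress tensor `S̄⁽¹⁾`. -/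
noncomputable def Sbar1 (ε κ m μ c : ℝ) (x1 x2 x3 : ℝ) : Matrix (Fin 3) (Fin 3) ℝ :=
  !![0, 0, μ * c / δf ε κ m x1 x2;
     0, 0, 0;
     μ * c / δf ε κ m x1 x2, 0, μ * c * x3 * d1δ κ m x1 x2 / (δf ε κ m x1 x2) ^ 2]

/-- `M = e(ū⁽¹⁾) − (1/(2μ))(S̄⁽¹⁾ − (tr S̄⁽¹⁾/3)·Id)`. -/
noncomputable def Mmat (ε κ m μ c : ℝ) (x1 x2 x3 : ℝ) : Matrix (Fin 3) (Fin 3) ℝ :=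
  symGrad (ubar1 ε κ m c) x1 x2 x3 -
    (1 / (2 * μ)) • (Sbar1 ε κ m μ c x1 x2 x3 -
      ((Sbar1 ε κ m μ c x1 x2 x3).trace / 3) • (1 : Matrix (Fin 3) (Fin 3) ℝ))

theorem hasDerivAt_sqrt_add_sq_rpow {x b : ℝ} (hx : 0 < x ^ 2 + b ^ 2) (a : ℝ) :
    HasDerivAt (fun t => Real.sqrt (t ^ 2 + b ^ 2) ^ a)
      (a * Real.sqrt (x ^ 2 + b ^ 2) ^ (a - 2) * x) x := by
  have hρ : 0 < Real.sqrt (x ^ 2 + b ^ 2) := Real.sqrt_pos.2 hx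
  have h := (((hasDerivAt_pow 2 x).add_const (b ^ 2)).sqrt hx.ne').rpow_const (p := a)
    (Or.inl hρ.ne')
  convert h using 1
  rw [show a - 2 = a - 1 - 1 by ring, Real.rpow_sub_one hρ.ne' (a - 1)]
  push_cast
  field_simp

theorem hasDerivAt_δf_fst (ε κ m : ℝ) {x1 x2 : ℝ} (hx : 0 < x1 ^ 2 + x2 ^ 2) :
    HasDerivAt (fun t => δf ε κ m t x2) (d1δ κ m x1 x2) x1 := by
  have h := ((hasDerivAt_sqrt_add_sq_rpow hx m).const_mul (2 * κ)).const_add ε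
  exact h.congr_deriv (by rw [d1δ]; ring)

theorem δf_comm (ε κ m x1 x2 : ℝ) : δf ε κ m x1 x2 = δf ε κ m x2 x1 := by
  simp only [δf, add_comm]

theorem hasDerivAt_δf_snd (ε κ m : ℝ) {x1 x2 : ℝ} (hx : 0 < x1 ^ 2 + x2 ^ 2) :
    HasDerivAt (fun t => δf ε κ m x1 t) (d1δ κ m x2 x1) x2 := by
  simp only [δf_comm ε κ m x1]
  exact hasDerivAt_δf_fst ε κ m (by linarith)

theorem hasDerivAt_d1δ_fst (κ m : ℝ) {x1 x2 : ℝ} (hx : 0 < x1 ^ 2 + x2 ^ 2) :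
    HasDerivAt (fun t => d1δ κ m t x2)
      (2 * κ * m * (Real.sqrt (x1 ^ 2 + x2 ^ 2) ^ (m - 2) +
        (m - 2) * Real.sqrt (x1 ^ 2 + x2 ^ 2) ^ (m - 2 - 2) * x1 ^ 2)) x1 := by
  have h := ((hasDerivAt_sqrt_add_sq_rpow hx (m - 2)).const_mul (2 * κ * m)).mul
    (hasDerivAt_id' x1)
  exact h.congr_deriv (by ring)

theorem hasDerivAt_d1δ_snd (κ m : ℝ) {x1 x2 : ℝ} (hx : 0 < x1 ^ 2 + x2 ^ 2) :
    HasDerivAt (fun t => d1δ κ m x1 t)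
      (2 * κ * m * ((m - 2) * Real.sqrt (x1 ^ 2 + x2 ^ 2) ^ (m - 2 - 2) * (x1 * x2))) x2 := by
  have hx' : 0 < x2 ^ 2 + x1 ^ 2 := by linarith
  have h := ((hasDerivAt_sqrt_add_sq_rpow hx' (m - 2)).const_mul (2 * κ * m)).mul_const x1
  simp only [add_comm _ (x1 ^ 2)] at h
  exact h.congr_deriv (by ring)

theorem hasDerivAt_shear_fst_component (c x3 : ℝ) {f : ℝ → ℝ} {f' x : ℝ} (hf : HasDerivAt f f' x)
    (h0 : f x ≠ 0) :
    HasDerivAt (fun t => c * (1 / 2 + x3 / f t)) (-(c * x3 * f' / f x ^ 2)) x := by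
  have h := ((((hasDerivAt_const x x3).div hf h0)).const_add (1 / 2)).const_mul c
  exact h.congr_deriv (by ring)

theorem hasDerivAt_shear_thd_component (c x3 : ℝ) {f g : ℝ → ℝ} {f' g' x : ℝ}
    (hf : HasDerivAt f f' x) (hg : HasDerivAt g g' x) (h0 : f x ≠ 0) :
    HasDerivAt (fun t => c * ((x3 / f t) ^ 2 - 1 / 4) * (g t / 2))
      (c * ((x3 / f x) ^ 2 - 1 / 4) * g' / 2 - c * (x3 / f x) ^ 2 * (f' * g x / f x)) x := by
  have h := (((((hasDerivAt_const x x3).div hf h0).pow 2).sub_const (1 / 4)).const_mul c).mul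
    (hg.div_const 2)
  refine h.congr_deriv ?_
  simp only [Pi.div_apply, Pi.pow_apply]
  norm_num
  field_simp
  ring

/-- The diagonal of `M` is `(-5/6, 1/6, 2/3)` times `c x₃ ∂₁δ / δ²`, and the leading part `c/(2δ)`
of the `13` entry cancels. -/
theorem trace_Mmat_sq (ε κ m c : ℝ) {μ x1 x2 x3 D2 P Q : ℝ} (hμ : μ ≠ 0)
    (hδ : δf ε κ m x1 x2 ≠ 0)
    (h1 : HasDerivAt (fun t => δf ε κ m t x2) (d1δ κ m x1 x2) x1)
    (h2 : HasDerivAt (fun t => δf ε κ m x1 t) D2 x2)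
    (hP : HasDerivAt (fun t => ubar1 ε κ m c t x2 x3 2) P x1)
    (hQ : HasDerivAt (fun t => ubar1 ε κ m c x1 t x3 2) Q x2) :
    (Mmat ε κ m μ c x1 x2 x3 * Mmat ε κ m μ c x1 x2 x3).trace =
      7 / 6 * (c * x3 * d1δ κ m x1 x2 / δf ε κ m x1 x2 ^ 2) ^ 2 +
        1 / 2 * (c * x3 * D2 / δf ε κ m x1 x2 ^ 2) ^ 2 + 1 / 2 * P ^ 2 + 1 / 2 * Q ^ 2 := by
  have e11 : deriv (fun t => ubar1 ε κ m c t x2 x3 0) x1 =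
      -(c * x3 * d1δ κ m x1 x2 / δf ε κ m x1 x2 ^ 2) :=
    (hasDerivAt_shear_fst_component c x3 h1 hδ).deriv
  have e12 : deriv (fun t => ubar1 ε κ m c x1 t x3 0) x2 =
      -(c * x3 * D2 / δf ε κ m x1 x2 ^ 2) :=
    (hasDerivAt_shear_fst_component c x3 h2 hδ).deriv
  have e13 : deriv (fun t => ubar1 ε κ m c x1 x2 t 0) x3 = c / δf ε κ m x1 x2 := by
    have h := (((hasDerivAt_id' x3).div_const (δf ε κ m x1 x2)).const_add (1 / 2)).const_mul c
    exact h.deriv.trans (by ring)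
  have e21 : deriv (fun t => ubar1 ε κ m c t x2 x3 1) x1 = 0 := deriv_const x1 (0 : ℝ)
  have e22 : deriv (fun t => ubar1 ε κ m c x1 t x3 1) x2 = 0 := deriv_const x2 (0 : ℝ)
  have e23 : deriv (fun t => ubar1 ε κ m c x1 x2 t 1) x3 = 0 := deriv_const x3 (0 : ℝ)
  have e33 : deriv (fun t => ubar1 ε κ m c x1 x2 t 2) x3 =
      c * x3 * d1δ κ m x1 x2 / δf ε κ m x1 x2 ^ 2 := by
    have h := (((((hasDerivAt_id' x3).div_const (δf ε κ m x1 x2)).pow 2).sub_const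
      (1 / 4)).const_mul c).mul_const (d1δ κ m x1 x2 / 2)
    refine h.deriv.trans ?_
    norm_num
    field_simp
  have e31 := hP.deriv
  have e32 := hQ.deriv
  have hS : (Sbar1 ε κ m μ c x1 x2 x3).trace =
      μ * c * x3 * d1δ κ m x1 x2 / (δf ε κ m x1 x2) ^ 2 := by
    simp [Sbar1, Matrix.trace_fin_three]
  simp only [Mmat, hS]
  simp [Matrix.trace_fin_three, Matrix.mul_apply, Fin.sum_univ_three, symGrad, grad3,
    Sbar1, e11, e12, e13, e21, e22, e23, e31, e32, e33]
  field_simp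
  ring

theorem rpow_sub_two_mul_sq {ρ : ℝ} (hρ : 0 < ρ) (a : ℝ) : ρ ^ (a - 2) * ρ ^ 2 = ρ ^ a := by
  rw [← Real.rpow_natCast ρ 2, ← Real.rpow_add hρ]
  norm_num

theorem sq_d1δ_le {ε κ m r x1 x2 : ℝ} (hε : 0 < ε) (hκ : 0 < κ) (hm : 2 ≤ m)
    (hx : 0 < x1 ^ 2 + x2 ^ 2) (hr : Real.sqrt (x1 ^ 2 + x2 ^ 2) < r) :
    d1δ κ m x1 x2 ^ 2 ≤ 2 * κ * m ^ 2 * r ^ (m - 2) * δf ε κ m x1 x2 := by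
  have hs : Real.sqrt (x1 ^ 2 + x2 ^ 2) ^ 2 = x1 ^ 2 + x2 ^ 2 := Real.sq_sqrt hx.le
  have hρ : 0 < Real.sqrt (x1 ^ 2 + x2 ^ 2) := Real.sqrt_pos.2 hx
  simp only [d1δ, δf]
  set ρ := Real.sqrt (x1 ^ 2 + x2 ^ 2)
  have hr0 : 0 < r := hρ.trans hr
  have hle : ρ ^ (m - 2) ≤ r ^ (m - 2) := Real.rpow_le_rpow hρ.le hr.le (by linarith)
  have hm' := rpow_sub_two_mul_sq hρ m
  have hp : 0 < ρ ^ (m - 2) := Real.rpow_pos_of_pos hρ _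
  calc (2 * κ * m * ρ ^ (m - 2) * x1) ^ 2
      = 4 * κ ^ 2 * m ^ 2 * (ρ ^ (m - 2)) ^ 2 * x1 ^ 2 := by ring
    _ ≤ 4 * κ ^ 2 * m ^ 2 * (ρ ^ (m - 2)) ^ 2 * ρ ^ 2 := by
        gcongr 4 * κ ^ 2 * m ^ 2 * (ρ ^ (m - 2)) ^ 2 * ?_
        nlinarith [sq_nonneg x2]
    _ = 2 * κ * m ^ 2 * ρ ^ (m - 2) * (2 * κ * ρ ^ m) := by rw [← hm']; ring
    _ ≤ 2 * κ * m ^ 2 * r ^ (m - 2) * (ε + 2 * κ * ρ ^ m) := by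
        gcongr
        linarith

/-- Pointwise bound for the derivatives of the third component of the shear velocity. -/
theorem abs_deriv_shear_thd_le {c G D E H A B d : ℝ} (hd : 0 < d) (hG : |G| ≤ 1 / 2)
    (hD : D ^ 2 ≤ A * d) (hE : E ^ 2 ≤ A * d) (hH : |H| ≤ B) :
    |c * (G ^ 2 - 1 / 4) * H / 2 - c * G ^ 2 * (E * D / d)| ≤ |c| * (A + B) := by
  have hG2 : G ^ 2 ≤ 1 / 4 := by
    have := sq_le_sq' (abs_le.1 hG).1 (abs_le.1 hG).2
    linarith
  have hED : |E * D / d| ≤ A := by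
    rw [abs_div, abs_of_pos hd, div_le_iff₀ hd, abs_le]
    constructor <;> nlinarith [sq_nonneg (E + D), sq_nonneg (E - D)]
  rw [show c * (G ^ 2 - 1 / 4) * H / 2 - c * G ^ 2 * (E * D / d) =
    c * (((G ^ 2 - 1 / 4) / 2) * H + (-(G ^ 2)) * (E * D / d)) by ring, abs_mul]
  refine mul_le_mul_of_nonneg_left ((abs_add_le _ _).trans ?_) (abs_nonneg c)
  rw [abs_mul, abs_mul, abs_neg, abs_of_nonneg (sq_nonneg G), add_comm A]
  have h1 : |(G ^ 2 - 1 / 4) / 2| ≤ 1 := abs_le.2 ⟨by nlinarith, by nlinarith⟩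
  refine add_le_add ?_ ?_
  · nlinarith [abs_nonneg H, mul_le_mul_of_nonneg_right h1 (abs_nonneg H)]
  · nlinarith [abs_nonneg (E * D / d), sq_nonneg G]

theorem exists_trace_Mmat_sq_le (κ r m μ c : ℝ) (hκ : 0 < κ) (hm : 2 ≤ m) (hμ : 0 < μ)
    (hr : 0 < r) :
    ∃ K > 0, ∀ ε ∈ Set.Ioo (0 : ℝ) 1, ∀ x1 x2 x3 : ℝ, x1 ≠ 0 →
      |x3| < ε / 2 + κ * Real.sqrt (x1 ^ 2 + x2 ^ 2) ^ m →
      Real.sqrt (x1 ^ 2 + x2 ^ 2) < r →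
      |(Mmat ε κ m μ c x1 x2 x3 * Mmat ε κ m μ c x1 x2 x3).trace| ≤ K / δf ε κ m x1 x2 := by
  set A := 2 * κ * m ^ 2 * r ^ (m - 2) with hA
  set B := 2 * κ * m * (m - 1) * r ^ (m - 2) with hB
  have hrp : 0 < r ^ (m - 2) := Real.rpow_pos_of_pos hr _
  have hA0 : 0 < A := by positivity
  have hB0 : 0 < B := by
    have : 0 < m - 1 := by linarith
    positivity
  have hrm : 0 < r ^ m := Real.rpow_pos_of_pos hr _
  refine ⟨1 + c ^ 2 * A + (|c| * (A + B)) ^ 2 * (1 + 2 * κ * r ^ m), by positivity, ?_⟩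
  rintro ε ⟨hε, hε1⟩ x1 x2 x3 hx1 hx3 hxr
  have hx : 0 < x1 ^ 2 + x2 ^ 2 := by positivity
  have hρ : 0 < Real.sqrt (x1 ^ 2 + x2 ^ 2) := Real.sqrt_pos.2 hx
  have hs : Real.sqrt (x1 ^ 2 + x2 ^ 2) ^ 2 = x1 ^ 2 + x2 ^ 2 := Real.sq_sqrt hx.le
  have hδ : 0 < δf ε κ m x1 x2 := by simp only [δf]; positivity
  have hδL : δf ε κ m x1 x2 ≤ 1 + 2 * κ * r ^ m := by
    simp only [δf]
    gcongr
  have hD := sq_d1δ_le hε hκ hm hx hxr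
  have hE : d1δ κ m x2 x1 ^ 2 ≤ A * δf ε κ m x1 x2 := by
    rw [δf_comm]
    exact sq_d1δ_le hε hκ hm (by linarith) (by rwa [add_comm])
  have hG : |x3 / δf ε κ m x1 x2| ≤ 1 / 2 := by
    rw [abs_div, abs_of_pos hδ, div_le_iff₀ hδ]
    simp only [δf]
    linarith
  have h1 := hasDerivAt_δf_fst ε κ m hx
  have h2 := hasDerivAt_δf_snd ε κ m hx
  have h3 := hasDerivAt_d1δ_fst κ m hx
  have h4 := hasDerivAt_d1δ_snd κ m hx
  have hP := hasDerivAt_shear_thd_component c x3 h1 h3 hδ.ne'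
  have hQ := hasDerivAt_shear_thd_component c x3 h2 h4 hδ.ne'
  have hle : Real.sqrt (x1 ^ 2 + x2 ^ 2) ^ (m - 2) ≤ r ^ (m - 2) :=
    Real.rpow_le_rpow hρ.le hxr.le (by linarith)
  have hp2 := rpow_sub_two_mul_sq hρ (m - 2)
  rw [hs] at hp2
  have hp4 : 0 < Real.sqrt (x1 ^ 2 + x2 ^ 2) ^ (m - 2 - 2) := Real.rpow_pos_of_pos hρ _
  have hm2 : 0 ≤ m - 2 := by linarith
  have key : ∀ y, |y| ≤ (m - 1) * Real.sqrt (x1 ^ 2 + x2 ^ 2) ^ (m - 2) →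
      |2 * κ * m * y| ≤ B := by
    intro y hy
    have hm1 : 0 ≤ m - 1 := by linarith
    rw [abs_mul, abs_of_pos (by positivity : 0 < 2 * κ * m), hB, mul_assoc (2 * κ * m)]
    gcongr
    exact hy.trans (by gcongr)
  have hH1 : |Real.sqrt (x1 ^ 2 + x2 ^ 2) ^ (m - 2) +
      (m - 2) * Real.sqrt (x1 ^ 2 + x2 ^ 2) ^ (m - 2 - 2) * x1 ^ 2| ≤
      (m - 1) * Real.sqrt (x1 ^ 2 + x2 ^ 2) ^ (m - 2) := by
    rw [← hp2, abs_of_nonneg (by positivity)]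
    linarith [mul_nonneg hm2 (mul_nonneg hp4.le (sq_nonneg x2))]
  have hH2 : |(m - 2) * Real.sqrt (x1 ^ 2 + x2 ^ 2) ^ (m - 2 - 2) * (x1 * x2)| ≤
      (m - 1) * Real.sqrt (x1 ^ 2 + x2 ^ 2) ^ (m - 2) := by
    have h5 := mul_nonneg hp4.le hx.le
    have h6 := mul_nonneg hm2 h5
    have h7 := mul_nonneg hm2 (mul_nonneg hp4.le (sq_nonneg (x1 - x2)))
    have h8 := mul_nonneg hm2 (mul_nonneg hp4.le (sq_nonneg (x1 + x2)))
    rw [← hp2, abs_le]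
    constructor <;> linarith
  have hPb := abs_deriv_shear_thd_le (c := c) hδ hG hD hD (key _ hH1)
  have hQb := abs_deriv_shear_thd_le (c := c) hδ hG hD hE (key _ hH2)
  rw [trace_Mmat_sq ε κ m c hμ.ne' hδ.ne' h1 h2 hP hQ, abs_of_nonneg (by positivity)]
  have hP2 := sq_le_sq' (abs_le.1 hPb).1 (abs_le.1 hPb).2
  have hQ2 := sq_le_sq' (abs_le.1 hQb).1 (abs_le.1 hQb).2
  set d := δf ε κ m x1 x2
  have hq : ∀ F : ℝ, F ^ 2 ≤ A * d → (c * x3 * F / d ^ 2) ^ 2 ≤ c ^ 2 * A / 4 / d := by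
    intro F hF
    have hG2 : (x3 / d) ^ 2 ≤ 1 / 4 := by
      have := sq_le_sq' (abs_le.1 hG).1 (abs_le.1 hG).2
      linarith
    calc (c * x3 * F / d ^ 2) ^ 2 = c ^ 2 * (x3 / d) ^ 2 * F ^ 2 / d ^ 2 := by
          field_simp
      _ ≤ c ^ 2 * (1 / 4) * (A * d) / d ^ 2 := by gcongr
      _ = c ^ 2 * A / 4 / d := by field_simp
  have hT : (|c| * (A + B)) ^ 2 ≤ (|c| * (A + B)) ^ 2 * (1 + 2 * κ * r ^ m) / d := by
    rw [le_div_iff₀ hδ]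
    gcongr
  have h10 : 0 ≤ c ^ 2 * A / 4 / d := by positivity
  have h11 : 0 ≤ 1 / d := by positivity
  have h12 : c ^ 2 * A / d = 4 * (c ^ 2 * A / 4 / d) := by ring
  rw [add_div, add_div, h12]
  linarith [hq _ hD, hq _ hE]

/-- The duality-gap integrand `tr(M²)` for the shear subproblem has integral over the
gap region `Ω_r(ε)` bounded uniformly in `ε ∈ (0,1)`. -/
theorem stmt13 (κ r m μ c : ℝ) (hκ : 0 < κ) (hr : 0 < r) (hm : 2 ≤ m) (hμ : 0 < μ) :
    ∃ C > 0, ∀ ε ∈ Set.Ioo (0 : ℝ) 1,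
      (∫ x in {p : ℝ × ℝ × ℝ |
          |p.2.2| < ε / 2 + κ * Real.sqrt (p.1 ^ 2 + p.2.1 ^ 2) ^ m ∧
          Real.sqrt (p.1 ^ 2 + p.2.1 ^ 2) < r},
        (Mmat ε κ m μ c x.1 x.2.1 x.2.2 * Mmat ε κ m μ c x.1 x.2.1 x.2.2).trace) ≤ C := by
  obtain ⟨K, hK, hbound⟩ := exists_trace_Mmat_sq_le κ r m μ c hκ hm hμ hr
  refine ⟨K * (2 * r) * (2 * r), by positivity, fun ε hε => ?_⟩
  set Ω : Set (ℝ × ℝ × ℝ) := {p | |p.2.2| < ε / 2 + κ * Real.sqrt (p.1 ^ 2 + p.2.1 ^ 2) ^ m ∧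
    Real.sqrt (p.1 ^ 2 + p.2.1 ^ 2) < r}
  have hΩ : MeasurableSet Ω := by
    simp only [Ω, Set.ofPred_and]
    exact (measurableSet_lt (by fun_prop) (by fun_prop)).inter
      (measurableSet_lt (by fun_prop) (by fun_prop))
  have hne : ∀ᵐ x : ℝ × ℝ × ℝ, x.1 ≠ 0 :=
    Measure.quasiMeasurePreserving_fst.ae (Measure.ae_ne volume (0 : ℝ))
  have hδpos : ∀ a b : ℝ, 0 < δf ε κ m a b := fun a b => by
    have := hε.1
    simp only [δf]
    positivity
  set g : ℝ × ℝ × ℝ → ENNReal := fun x => ENNReal.ofReal (K / δf ε κ m x.1 x.2.1)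
  have hdom : ∀ x1 x2 x3 : ℝ, Ω.indicator g (x1, x2, x3) ≤
      (Set.Ioo (-r) r).indicator (fun _ => (Set.Ioo (-r) r).indicator (fun _ =>
        (Set.Ioo (-(δf ε κ m x1 x2 / 2)) (δf ε κ m x1 x2 / 2)).indicator
          (fun _ => ENNReal.ofReal (K / δf ε κ m x1 x2)) x3) x2) x1 := by
    intro x1 x2 x3
    by_cases hx : (x1, x2, x3) ∈ Ω
    swap
    · rw [Set.indicator_of_notMem hx]
      exact zero_le
    rw [Set.indicator_of_mem hx]
    obtain ⟨h3, hρ⟩ := hx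
    have h1 : x1 ∈ Set.Ioo (-r) r :=
      abs_lt.1 ((Real.abs_le_sqrt (by nlinarith [sq_nonneg x2])).trans_lt hρ)
    have h2 : x2 ∈ Set.Ioo (-r) r :=
      abs_lt.1 ((Real.abs_le_sqrt (by nlinarith [sq_nonneg x1])).trans_lt hρ)
    have h3' : x3 ∈ Set.Ioo (-(δf ε κ m x1 x2 / 2)) (δf ε κ m x1 x2 / 2) :=
      abs_lt.1 (h3.trans_le (by simp only [δf]; linarith))
    rw [Set.indicator_of_mem h1, Set.indicator_of_mem h2, Set.indicator_of_mem h3']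
  have hinner : ∀ x1 x2 : ℝ, ∫⁻ x3, (Set.Ioo (-(δf ε κ m x1 x2 / 2))
      (δf ε κ m x1 x2 / 2)).indicator (fun _ => ENNReal.ofReal (K / δf ε κ m x1 x2)) x3 =
      ENNReal.ofReal K := by
    intro x1 x2
    rw [lintegral_indicator_const measurableSet_Ioo, Real.volume_Ioo,
      ← ENNReal.ofReal_mul (div_pos hK (hδpos x1 x2)).le]
    congr 1
    have := hδpos x1 x2
    field_simp
    ring
  have hlin : ∫⁻ x in Ω, g x ≤ ENNReal.ofReal (K * (2 * r) * (2 * r)) := by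
    rw [← lintegral_indicator hΩ]
    calc ∫⁻ x, Ω.indicator g x
        ≤ ∫⁻ x1, ∫⁻ x2, ∫⁻ x3, Ω.indicator g (x1, x2, x3) :=
          (lintegral_prod_le _).trans (lintegral_mono fun x1 => lintegral_prod_le _)
      _ ≤ ∫⁻ x1, ∫⁻ x2, ∫⁻ x3, (Set.Ioo (-r) r).indicator (fun _ =>
            (Set.Ioo (-r) r).indicator (fun _ =>
              (Set.Ioo (-(δf ε κ m x1 x2 / 2)) (δf ε κ m x1 x2 / 2)).indicator
                (fun _ => ENNReal.ofReal (K / δf ε κ m x1 x2)) x3) x2) x1 :=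
          lintegral_mono fun x1 => lintegral_mono fun x2 => lintegral_mono fun x3 =>
            hdom x1 x2 x3
      _ = ∫⁻ x1, (Set.Ioo (-r) r).indicator (fun _ =>
            ∫⁻ x2, (Set.Ioo (-r) r).indicator (fun _ => ENNReal.ofReal K) x2) x1 := by
          refine lintegral_congr fun x1 => ?_
          by_cases h1 : x1 ∈ Set.Ioo (-r) r
          · simp only [Set.indicator_of_mem h1]
            refine lintegral_congr fun x2 => ?_
            by_cases h2 : x2 ∈ Set.Ioo (-r) r
            · simp only [Set.indicator_of_mem h2, hinner]
            · simp only [Set.indicator_of_notMem h2, lintegral_zero]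
          · simp only [Set.indicator_of_notMem h1, lintegral_zero]
      _ = ENNReal.ofReal (K * (2 * r) * (2 * r)) := by
          rw [lintegral_indicator_const measurableSet_Ioo,
            lintegral_indicator_const measurableSet_Ioo, Real.volume_Ioo,
            sub_neg_eq_add, ← two_mul, ← ENNReal.ofReal_mul hK.le,
            ← ENNReal.ofReal_mul (by positivity)]
  have hint : ‖∫ x in Ω,
      (Mmat ε κ m μ c x.1 x.2.1 x.2.2 * Mmat ε κ m μ c x.1 x.2.1 x.2.2).trace‖ₑ ≤
      ENNReal.ofReal (K * (2 * r) * (2 * r)) := by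
    refine (enorm_integral_le_lintegral_enorm _).trans (le_trans (lintegral_mono_ae ?_) hlin)
    filter_upwards [ae_restrict_of_ae hne, ae_restrict_mem hΩ] with x hx0 hxΩ
    rw [Real.enorm_eq_ofReal_abs]
    exact ENNReal.ofReal_le_ofReal (hbound ε hε _ _ _ hx0 hxΩ.1 hxΩ.2)
  rw [Real.enorm_eq_ofReal_abs, ENNReal.ofReal_le_ofReal_iff (by positivity)] at hint
  exact (le_abs_self _).trans hint
end

section
/- Fix κ > 0, r > 0, μ > 0, ω1, ω2, ω3 ∈ ℝ and set m = 2. For ε ∈ (0,1) let Ω_r(ε) = {(x',x3) ∈ ℝ³ : |x3| < ε/2 + κ|x'|², |x'| < r}, δ(x') = ε + 2κ|x'|², G(x) = x3/δ(x'), φ₅(x) = (ω2(x3 − ε/2) − ω3x2)e₁ + (−ω1(x3 − ε/2) + ω3x1)e₂, F₅(x) = (1/2)(ω2(x3−ε/2) − ω3x2)∂₁δ + (1/2)(−ω1(x3−ε/2) + ω3x1)∂₂δ + (δ/4)(ω1∂₂δ − ω2∂₁δ), and ū⁽⁵⁾(x) = (1/2 + G)φ₅(x) + (G² − 1/4)F₅(x)e₃.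 Then there exists C > 0, independent of ε, such that for all ε ∈ (0,1): ∫_{Ω_r(ε)} tr(e(ū⁽⁵⁾)(x)²) dx ≤ C, where e(v) = (∇v + (∇v)ᵀ)/2. -/
open Matrix MeasureTheory

/-- Boundary field `φ₅ = (ω2(x₃−ε/2) − ω3x₂)e₁ + (−ω1(x₃−ε/2) + ω3x₁)e₂`. -/
noncomputable def φ5 (ε ω1 ω2 ω3 x1 x2 x3 : ℝ) : Fin 3 → ℝ :=
  ![ω2 * (x3 - ε / 2) - ω3 * x2, -ω1 * (x3 - ε / 2) + ω3 * x1, 0]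

/-- Correction `F₅ = (1/2)(ω2(x₃−ε/2)−ω3x₂)∂₁δ + (1/2)(−ω1(x₃−ε/2)+ω3x₁)∂₂δ
+ (δ/4)(ω1∂₂δ − ω2∂₁δ)`, with `∂ᵢδ = 4κxᵢ` (`m = 2`). -/
noncomputable def F5 (ε κ ω1 ω2 ω3 x1 x2 x3 : ℝ) : ℝ :=
  (1 / 2) * (ω2 * (x3 - ε / 2) - ω3 * x2) * (4 * κ * x1)
    + (1 / 2) * (-ω1 * (x3 - ε / 2) + ω3 * x1) * (4 * κ * x2)
    + (δ2 ε κ x1 x2 / 4) * (ω1 * (4 * κ * x2) - ω2 * (4 * κ * x1))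

/-- The approximate velocity `ū⁽⁵⁾ = (1/2+G)φ₅ + (G²−1/4)F₅e₃`, `G = x₃/δ`. -/
noncomputable def ubar5 (ε κ ω1 ω2 ω3 : ℝ) (x1 x2 x3 : ℝ) : Fin 3 → ℝ :=
  (1 / 2 + x3 / δ2 ε κ x1 x2) • φ5 ε ω1 ω2 ω3 x1 x2 x3
    + (((x3 / δ2 ε κ x1 x2) ^ 2 - 1 / 4) * F5 ε κ ω1 ω2 ω3 x1 x2 x3) • ![0, 0, 1]

section Components

variable (ε κ ω1 ω2 ω3 x1 x2 x3 : ℝ)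

lemma ubar5_zero : ubar5 ε κ ω1 ω2 ω3 x1 x2 x3 0
    = (1 / 2 + x3 / δ2 ε κ x1 x2) * (ω2 * (x3 - ε / 2) - ω3 * x2) := by
  simp [ubar5, φ5]

lemma ubar5_one : ubar5 ε κ ω1 ω2 ω3 x1 x2 x3 1
    = (1 / 2 + x3 / δ2 ε κ x1 x2) * (-ω1 * (x3 - ε / 2) + ω3 * x1) := by
  simp [ubar5, φ5]

/-- The `ω3` contributions to `F5` cancel, which makes `F5` of order `δ |x'|`. -/
lemma F5_eq : F5 ε κ ω1 ω2 ω3 x1 x2 x3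
    = κ * (x1 * ω2 - x2 * ω1) * (2 * x3 - ε - δ2 ε κ x1 x2) := by
  simp only [F5]
  ring

lemma ubar5_two : ubar5 ε κ ω1 ω2 ω3 x1 x2 x3 2
    = ((x3 / δ2 ε κ x1 x2) ^ 2 - 1 / 4)
      * (κ * (x1 * ω2 - x2 * ω1) * (2 * x3 - ε - δ2 ε κ x1 x2)) := by
  simp [ubar5, φ5, F5_eq]

lemma hasDerivAt_δ2_left : HasDerivAt (fun t => δ2 ε κ t x2) (4 * κ * x1) x1 := by
  have h := (((hasDerivAt_pow 2 x1).add_const (x2 ^ 2)).const_mul (2 * κ)).const_add ε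
  exact h.congr_deriv (by norm_num; ring)

lemma hasDerivAt_δ2_right : HasDerivAt (fun t => δ2 ε κ x1 t) (4 * κ * x2) x2 := by
  have h := (((hasDerivAt_pow 2 x2).const_add (x1 ^ 2)).const_mul (2 * κ)).const_add ε
  exact h.congr_deriv (by norm_num; ring)

end Components

/-- The matrix `√δ ∇ū⁽⁵⁾` in the rescaled variables `q = x₃/δ`, `e = ε/δ`, `yᵢ = xᵢ/√δ`,
`s = √δ`, in which it is polynomial. -/
noncomputable def scaledGrad (κ ω1 ω2 ω3 q e y1 y2 s : ℝ) : Matrix (Fin 3) (Fin 3) ℝ :=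
  let p1 := ω2 * s * (q - e / 2) - ω3 * y2
  let p2 := -ω1 * s * (q - e / 2) + ω3 * y1
  let w := y1 * ω2 - y2 * ω1
  let t := 2 * q - e - 1
  !![-4 * κ * y1 * q * s * p1,
      -4 * κ * y2 * q * s * p1 - s * (1 / 2 + q) * ω3,
      p1 + s * (1 / 2 + q) * ω2;
    -4 * κ * y1 * q * s * p2 + s * (1 / 2 + q) * ω3,
      -4 * κ * y2 * q * s * p2,
      p2 - s * (1 / 2 + q) * ω1;
    s ^ 3 * (-8 * κ ^ 2 * q ^ 2 * y1 * w * t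
      + (q ^ 2 - 1 / 4) * (κ * ω2 * t - 4 * κ ^ 2 * w * y1)),
      s ^ 3 * (-8 * κ ^ 2 * q ^ 2 * y2 * w * t
        + (q ^ 2 - 1 / 4) * (-κ * ω1 * t - 4 * κ ^ 2 * w * y2)),
      s ^ 2 * (2 * q * κ * w * t + (q ^ 2 - 1 / 4) * 2 * κ * w)]

lemma grad3_ubar5_eq (κ ω1 ω2 ω3 q e y1 y2 s : ℝ) (hs : s ≠ 0)
    (hδ : δ2 (e * s ^ 2) κ (s * y1) (s * y2) = s ^ 2) :
    grad3 (ubar5 (e * s ^ 2) κ ω1 ω2 ω3) (s * y1) (s * y2) (q * s ^ 2)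
      = s⁻¹ • scaledGrad κ ω1 ω2 ω3 q e y1 y2 s := by
  have hδ0 : δ2 (e * s ^ 2) κ (s * y1) (s * y2) ≠ 0 := by rw [hδ]; positivity
  have d1 := hasDerivAt_δ2_left (e * s ^ 2) κ (s * y1) (s * y2)
  have d2 := hasDerivAt_δ2_right (e * s ^ 2) κ (s * y1) (s * y2)
  have i1 := fun c : ℝ => hasDerivAt_id' c
  have G1 := (hasDerivAt_const (s * y1) (q * s ^ 2)).div d1 hδ0
  have G2 := (hasDerivAt_const (s * y2) (q * s ^ 2)).div d2 hδ0
  have G3 := (i1 (q * s ^ 2)).div_const (δ2 (e * s ^ 2) κ (s * y1) (s * y2))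
  have W1 := (((i1 (s * y1)).mul_const ω2).sub_const (s * y2 * ω1)).const_mul κ
  have W2 := (((i1 (s * y2)).mul_const ω1).const_sub (s * y1 * ω2)).const_mul κ
  have T1 := d1.const_sub (2 * (q * s ^ 2) - e * s ^ 2)
  have T2 := d2.const_sub (2 * (q * s ^ 2) - e * s ^ 2)
  have T3 := (((i1 (q * s ^ 2)).const_mul 2).sub_const (e * s ^ 2)).sub_const
    (δ2 (e * s ^ 2) κ (s * y1) (s * y2))
  have P3 := (i1 (q * s ^ 2)).sub_const (e * s ^ 2 / 2)
  ext k l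
  fin_cases k <;> fin_cases l <;>
    simp only [grad3, scaledGrad, Matrix.of_apply, Matrix.smul_apply, Fin.mk_zero, Fin.mk_one,
      Fin.reduceFinMk, Matrix.cons_val, smul_eq_mul, Fin.isValue,
      ubar5_zero, ubar5_one, ubar5_two]
  · exact (((G1.const_add (1 / 2)).mul_const _).congr_deriv (by
      rw [hδ]; field_simp; ring)).deriv
  · exact (((G2.const_add (1 / 2)).mul
      (((i1 (s * y2)).const_mul ω3).const_sub _)).congr_deriv (by
      simp only [hδ, Pi.div_apply]; field_simp; ring)).deriv
  · exact (((G3.const_add (1 / 2)).mul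
      ((P3.const_mul ω2).sub_const _)).congr_deriv (by
      simp only [hδ]; field_simp)).deriv
  · exact (((G1.const_add (1 / 2)).mul
      (((i1 (s * y1)).const_mul ω3).const_add _)).congr_deriv (by
      simp only [hδ, Pi.div_apply]; field_simp; ring)).deriv
  · exact (((G2.const_add (1 / 2)).mul_const _).congr_deriv (by
      rw [hδ]; field_simp; ring)).deriv
  · exact (((G3.const_add (1 / 2)).mul
      ((P3.const_mul (-ω1)).add_const _)).congr_deriv (by
      simp only [hδ]; field_simp; ring)).deriv
  · exact ((((G1.pow 2).sub_const (1 / 4)).mul (W1.mul T1)).congr_deriv (by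
      simp only [hδ, Pi.div_apply, Pi.pow_apply, Pi.mul_apply]; field_simp; ring)).deriv
  · exact ((((G2.pow 2).sub_const (1 / 4)).mul (W2.mul T2)).congr_deriv (by
      simp only [hδ, Pi.div_apply, Pi.pow_apply, Pi.mul_apply]; field_simp; ring)).deriv
  · exact ((((G3.pow 2).sub_const (1 / 4)).mul (T3.const_mul _)).congr_deriv (by
      simp only [hδ, Pi.pow_apply]; field_simp; ring)).deriv

/-- The trace `tr(((D + Dᵀ)/2)²)` of the rescaled gradient `D`. -/
noncomputable def scaledEnergy (κ ω1 ω2 ω3 q e y1 y2 s : ℝ) : ℝ :=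
  let S := (1 / 2 : ℝ) • (scaledGrad κ ω1 ω2 ω3 q e y1 y2 s
    + (scaledGrad κ ω1 ω2 ω3 q e y1 y2 s)ᵀ)
  (S * S).trace

lemma continuous_scaledEnergy (κ ω1 ω2 ω3 : ℝ) :
    Continuous fun z : ℝ × ℝ × ℝ × ℝ × ℝ =>
      scaledEnergy κ ω1 ω2 ω3 z.1 z.2.1 z.2.2.1 z.2.2.2.1 z.2.2.2.2 := by
  have h : Continuous fun z : ℝ × ℝ × ℝ × ℝ × ℝ =>
      scaledGrad κ ω1 ω2 ω3 z.1 z.2.1 z.2.2.1 z.2.2.2.1 z.2.2.2.2 := by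
    refine continuous_matrix fun i j => ?_
    fin_cases i <;> fin_cases j <;> simp [scaledGrad] <;> fun_prop
  unfold scaledEnergy
  fun_prop

lemma exists_energy_le (κ r ω1 ω2 ω3 : ℝ) (hκ : 0 < κ) :
    ∃ K ≥ 0, ∀ ε ∈ Set.Ioo (0 : ℝ) 1, ∀ x1 x2 x3 : ℝ, x1 ^ 2 + x2 ^ 2 ≤ r ^ 2 →
      |x3| ≤ δ2 ε κ x1 x2 / 2 →
      |(symGrad (ubar5 ε κ ω1 ω2 ω3) x1 x2 x3
        * symGrad (ubar5 ε κ ω1 ω2 ω3) x1 x2 x3).trace| ≤ K / δ2 ε κ x1 x2 := by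
  set c := √(1 / (2 * κ))
  set B := Set.Icc ((-1, 0, -c, -c, 0) : ℝ × ℝ × ℝ × ℝ × ℝ)
    (1, 1, c, c, √(1 + 2 * κ * r ^ 2))
  obtain ⟨K, hK⟩ := (isCompact_Icc : IsCompact B).exists_bound_of_continuousOn
    (continuous_scaledEnergy κ ω1 ω2 ω3).continuousOn
  refine ⟨max K 0, le_max_right _ _, fun ε hε x1 x2 x3 hr hx3 => ?_⟩
  have hd : ε ≤ δ2 ε κ x1 x2 := by
    have : 0 ≤ 2 * κ * (x1 ^ 2 + x2 ^ 2) := by positivity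
    simp only [δ2]; linarith
  have hd0 : 0 < δ2 ε κ x1 x2 := hε.1.trans_le hd
  obtain ⟨s, hs⟩ : ∃ s, s = √(δ2 ε κ x1 x2) := ⟨_, rfl⟩
  have hs0 : 0 < s := hs ▸ Real.sqrt_pos.2 hd0
  have hs2 : δ2 ε κ x1 x2 = s ^ 2 := by rw [hs, Real.sq_sqrt hd0.le]
  have hsS : s ≤ √(1 + 2 * κ * r ^ 2) := by
    rw [hs]
    refine Real.sqrt_le_sqrt ?_
    have := mul_le_mul_of_nonneg_left hr (by positivity : 0 ≤ 2 * κ)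
    simp only [δ2]; linarith [hε.2]
  have hy : ∀ x : ℝ, x ^ 2 ≤ x1 ^ 2 + x2 ^ 2 → |x / s| ≤ c := fun x hx => by
    refine Real.abs_le_sqrt ?_
    rw [div_pow, ← hs2, div_le_div_iff₀ hd0 (by positivity)]
    have := mul_le_mul_of_nonneg_left hx (by positivity : 0 ≤ 2 * κ)
    simp only [δ2]; linarith [hε.1]
  have hy1 := abs_le.1 (hy x1 (by nlinarith [sq_nonneg x2]))
  have hy2 := abs_le.1 (hy x2 (by nlinarith [sq_nonneg x1]))
  have hq : |x3 / s ^ 2| ≤ 1 := by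
    rw [← hs2, abs_div, abs_of_pos hd0, div_le_one hd0]; linarith
  have he0 : 0 ≤ ε / s ^ 2 := by have := hε.1; positivity
  have he1 : ε / s ^ 2 ≤ 1 := by rwa [← hs2, div_le_one hd0]
  have hmem : ((x3 / s ^ 2, ε / s ^ 2, x1 / s, x2 / s, s) : ℝ × ℝ × ℝ × ℝ × ℝ) ∈ B :=
    ⟨⟨(abs_le.1 hq).1, he0, hy1.1, hy2.1, hs0.le⟩, ⟨(abs_le.1 hq).2, he1, hy1.2, hy2.2, hsS⟩⟩
  have hbound := hK _ hmem
  have hgrad := grad3_ubar5_eq κ ω1 ω2 ω3 (x3 / s ^ 2) (ε / s ^ 2) (x1 / s) (x2 / s) s hs0.ne'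
  rw [div_mul_cancel₀ _ (by positivity), div_mul_cancel₀ _ (by positivity),
    mul_div_cancel₀ _ hs0.ne', mul_div_cancel₀ _ hs0.ne'] at hgrad
  have htr : (symGrad (ubar5 ε κ ω1 ω2 ω3) x1 x2 x3
        * symGrad (ubar5 ε κ ω1 ω2 ω3) x1 x2 x3).trace
      = scaledEnergy κ ω1 ω2 ω3 (x3 / s ^ 2) (ε / s ^ 2) (x1 / s) (x2 / s) s / s ^ 2 := by
    simp only [symGrad, hgrad hs2, scaledEnergy, Matrix.transpose_smul, ← smul_add,
      smul_comm (1 / 2 : ℝ) s⁻¹, Matrix.smul_mul, Matrix.mul_smul, Matrix.trace_smul, smul_eq_mul]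
    field_simp
  rw [htr, hs2, abs_div, abs_of_pos (by positivity : 0 < s ^ 2)]
  gcongr
  exact hbound.trans (le_max_left _ _)

/-- A weight `K / d(x')` integrates over a layer of width `d(x')` above a square of side `2r`
to at most `4 r² K`. -/
lemma lintegral_layer_le (r K : ℝ) (hr : 0 ≤ r) (hK : 0 ≤ K) (d : ℝ → ℝ → ℝ)
    (hd : ∀ x y, 0 < d x y) (S : Set (ℝ × ℝ × ℝ)) (hS : MeasurableSet S)
    (hSd : ∀ p ∈ S, p.1 ∈ Set.Icc (-r) r ∧ p.2.1 ∈ Set.Icc (-r) r ∧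
      p.2.2 ∈ Set.Icc (-(d p.1 p.2.1 / 2)) (d p.1 p.2.1 / 2)) :
    ∫⁻ p in S, ENNReal.ofReal (K / d p.1 p.2.1) ≤ ENNReal.ofReal (4 * r ^ 2 * K) := by
  have hinner : ∀ x y : ℝ, ∫⁻ z, (Set.Icc (-(d x y / 2)) (d x y / 2)).indicator
      (fun _ => ENNReal.ofReal (K / d x y)) z = ENNReal.ofReal K := fun x y => by
    rw [lintegral_indicator_const measurableSet_Icc, Real.volume_Icc,
      ← ENNReal.ofReal_mul (div_nonneg hK (hd x y).le)]
    congr 1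
    have := (hd x y).ne'
    field_simp
    ring
  have hmid : ∀ x : ℝ, ∫⁻ q : ℝ × ℝ, (Set.Icc (-r) r).indicator (fun y =>
      (Set.Icc (-(d x y / 2)) (d x y / 2)).indicator
        (fun _ => ENNReal.ofReal (K / d x y)) q.2) q.1 ≤ ENNReal.ofReal (2 * r * K) := fun x => by
    refine (lintegral_prod_le _).trans ?_
    calc _ = ∫⁻ y, (Set.Icc (-r) r).indicator (fun _ => ENNReal.ofReal K) y := by
          refine lintegral_congr fun y => ?_
          by_cases hy : y ∈ Set.Icc (-r) r
          · simp only [Set.indicator_of_mem hy, hinner]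
          · simp only [Set.indicator_of_notMem hy, lintegral_zero]
      _ ≤ _ := by
          rw [lintegral_indicator_const measurableSet_Icc, Real.volume_Icc,
            ← ENNReal.ofReal_mul hK]
          exact ENNReal.ofReal_le_ofReal (by linarith)
  rw [← lintegral_indicator hS]
  calc _ ≤ ∫⁻ p : ℝ × ℝ × ℝ, (Set.Icc (-r) r).indicator (fun x => (Set.Icc (-r) r).indicator
        (fun y => (Set.Icc (-(d x y / 2)) (d x y / 2)).indicator
          (fun _ => ENNReal.ofReal (K / d x y)) p.2.2) p.2.1) p.1 := by
        refine lintegral_mono (Set.indicator_le fun p hp => ?_)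
        obtain ⟨h1, h2, h3⟩ := hSd p hp
        rw [Set.indicator_of_mem h1, Set.indicator_of_mem h2, Set.indicator_of_mem h3]
    _ ≤ ∫⁻ x, (Set.Icc (-r) r).indicator (fun _ => ENNReal.ofReal (2 * r * K)) x := by
        refine (lintegral_prod_le _).trans (lintegral_mono fun x => ?_)
        by_cases hx : x ∈ Set.Icc (-r) r
        · simp only [Set.indicator_of_mem hx]
          exact hmid x
        · simp only [Set.indicator_of_notMem hx, lintegral_zero, le_refl]
    _ = _ := by
        rw [lintegral_indicator_const measurableSet_Icc, Real.volume_Icc,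
          ← ENNReal.ofReal_mul (by positivity)]
        congr 1
        ring

/-- The duality-gap integrand `tr(e(ū⁽⁵⁾)²)` for the tangential-rotation subproblem
has integral over the gap region `Ω_r(ε)` bounded uniformly in `ε ∈ (0,1)`. -/
theorem stmt14 (κ r μ ω1 ω2 ω3 : ℝ) (hκ : 0 < κ) (hr : 0 < r) (hμ : 0 < μ) :
    ∃ C > 0, ∀ ε ∈ Set.Ioo (0 : ℝ) 1,
      (∫ x in {p : ℝ × ℝ × ℝ |
          |p.2.2| < ε / 2 + κ * (p.1 ^ 2 + p.2.1 ^ 2) ∧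
          Real.sqrt (p.1 ^ 2 + p.2.1 ^ 2) < r},
        (symGrad (ubar5 ε κ ω1 ω2 ω3) x.1 x.2.1 x.2.2
          * symGrad (ubar5 ε κ ω1 ω2 ω3) x.1 x.2.1 x.2.2).trace) ≤ C := by
  obtain ⟨K, hK0, hK⟩ := exists_energy_le κ r ω1 ω2 ω3 hκ
  refine ⟨4 * r ^ 2 * K + 1, by positivity, fun ε hε => ?_⟩
  set S := {p : ℝ × ℝ × ℝ | |p.2.2| < ε / 2 + κ * (p.1 ^ 2 + p.2.1 ^ 2) ∧
    Real.sqrt (p.1 ^ 2 + p.2.1 ^ 2) < r}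
  have hS : MeasurableSet S := by
    refine (IsOpen.and (isOpen_lt ?_ ?_) (isOpen_lt ?_ ?_)).measurableSet <;> fun_prop
  have hd0 : ∀ x y, 0 < δ2 ε κ x y := fun x y => by
    have := hε.1
    unfold δ2
    positivity
  have hsq : ∀ p ∈ S, p.1 ^ 2 + p.2.1 ^ 2 ≤ r ^ 2 := fun p hp =>
    ((Real.sqrt_lt' hr).1 hp.2).le
  have hx3 : ∀ p ∈ S, |p.2.2| ≤ δ2 ε κ p.1 p.2.1 / 2 := fun p hp => by
    refine hp.1.le.trans_eq ?_
    unfold δ2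
    ring
  have hlayer := lintegral_layer_le r K hr.le hK0 (δ2 ε κ) hd0 S hS fun p hp =>
    ⟨abs_le.1 (abs_le_of_sq_le_sq (by nlinarith [hsq p hp, sq_nonneg p.2.1]) hr.le),
      abs_le.1 (abs_le_of_sq_le_sq (by nlinarith [hsq p hp, sq_nonneg p.1]) hr.le),
      abs_le.1 (hx3 p hp)⟩
  refine (Real.le_norm_self _).trans ((norm_integral_le_lintegral_norm _).trans ?_)
  refine (ENNReal.toReal_le_of_le_ofReal (by positivity) (le_trans ?_ hlayer)).trans
    (le_add_of_nonneg_right zero_le_one)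
  exact setLIntegral_mono' hS fun p hp => ENNReal.ofReal_le_ofReal
    (hK ε hε _ _ _ (hsq p hp) (hx3 p hp))
end

section
/- Fix κ > 0, 0 < r, R > 0, m ≥ 2, μ > 0 and U3 ∈ ℝ. For ε ∈ (0,1) let δ(x') = ε + 2κ|x'|^m, h(x') = κ|x'|^m, G(x) = x3/δ(x'), K(x') = 3(x'·∇'δ)/δ − 2 with x'·∇'δ = 2κm|x'|^m, ū⁽³⁾(x) = U3[(1/2+G)e₃ + (G²−1/4)((3x1/δ)e₁ + (3x2/δ)e₂ + G·K e₃)], p̄⁽³⁾(x) = μU3[(3x3²/δ³)K + 3∫_{r²}^{|x'|²}(ε+2κt^{m/2})^{−3}dt], and σ[ū⁽³⁾,p̄⁽³⁾] = 2μ e(ū⁽³⁾) − p̄⁽³⁾·Id₃. Then there exists C > 0, independent of ε, such that for all ε ∈ (0,1): ‖ ∫_{|x'|<r} (x1, x2, h(x') − R) × [σ[ū⁽³⁾,p̄⁽³⁾](x', δ(x')/2)·(∂₁h, ∂₂h, −1)] dx' ‖ ≤ C. -/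
open Matrix MeasureTheory

/-- `K(x') = 3(x'·∇'δ)/δ − 2` with `x'·∇'δ = 2κm|x'|^m`. -/
noncomputable def Kf (ε κ m x1 x2 : ℝ) : ℝ :=
  3 * (2 * κ * m * Real.sqrt (x1 ^ 2 + x2 ^ 2) ^ m) / δf ε κ m x1 x2 - 2

/-- The approximate squeeze velocity
`ū⁽³⁾ = U3[(1/2+G)e₃ + (G²−1/4)((3x₁/δ)e₁ + (3x₂/δ)e₂ + G·K e₃)]`. -/
noncomputable def ubar3 (ε κ m U3 : ℝ) (x1 x2 x3 : ℝ) : Fin 3 → ℝ :=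
  ![U3 * (((x3 / δf ε κ m x1 x2) ^ 2 - 1 / 4) * (3 * x1 / δf ε κ m x1 x2)),
    U3 * (((x3 / δf ε κ m x1 x2) ^ 2 - 1 / 4) * (3 * x2 / δf ε κ m x1 x2)),
    U3 * ((1 / 2 + x3 / δf ε κ m x1 x2) +
      ((x3 / δf ε κ m x1 x2) ^ 2 - 1 / 4) * (x3 / δf ε κ m x1 x2) * Kf ε κ m x1 x2)]

/-- The approximate squeeze pressure
`p̄⁽³⁾ = μU3[(3x₃²/δ³)K + 3∫_{r²}^{|x'|²}(ε+2κt^{m/2})^{−3}dt]`. -/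
noncomputable def pbar3 (ε κ r m μ U3 x1 x2 x3 : ℝ) : ℝ :=
  μ * U3 * (3 * x3 ^ 2 / (δf ε κ m x1 x2) ^ 3 * Kf ε κ m x1 x2
    + 3 * ∫ t in (r ^ 2)..(x1 ^ 2 + x2 ^ 2), (ε + 2 * κ * t ^ (m / 2)) ^ (-(3 : ℝ)))

/-- Cauchy stress `σ[ū⁽³⁾,p̄⁽³⁾] = 2μe(ū⁽³⁾) − p̄⁽³⁾·Id`. -/
noncomputable def sigma3 (ε κ r m μ U3 x1 x2 x3 : ℝ) : Matrix (Fin 3) (Fin 3) ℝ :=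
  (2 * μ) • symGrad (ubar3 ε κ m U3) x1 x2 x3
    - pbar3 ε κ r m μ U3 x1 x2 x3 • (1 : Matrix (Fin 3) (Fin 3) ℝ)

/-- Euclidean norm on `ℝ³`. -/
noncomputable def enorm3 (v : Fin 3 → ℝ) : ℝ :=
  Real.sqrt ((v 0) ^ 2 + (v 1) ^ 2 + (v 2) ^ 2)

theorem setIntegral_eq_zero_of_odd {α : Type*} [MeasurableSpace α] {ν : Measure α} {T : α → α}
    (hT : MeasurePreserving T ν ν) (hTe : MeasurableEmbedding T) {s : Set α} (hs : T ⁻¹' s = s)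
    {f : α → ℝ} (hf : ∀ p, f (T p) = -f p) : ∫ p in s, f p ∂ν = 0 := by
  have h := hT.setIntegral_preimage_emb hTe f s
  rw [hs] at h
  simp only [hf, integral_neg] at h
  linarith

theorem measurePreserving_neg_fst :
    MeasurePreserving (fun p : ℝ × ℝ => (-p.1, p.2)) volume volume :=
  (Measure.measurePreserving_neg (volume : Measure ℝ)).prod (MeasurePreserving.id volume)

theorem measurePreserving_neg_snd :
    MeasurePreserving (fun p : ℝ × ℝ => (p.1, -p.2)) volume volume :=
  (MeasurePreserving.id volume).prod (Measure.measurePreserving_neg (volume : Measure ℝ))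

theorem measurableEmbedding_neg_fst : MeasurableEmbedding (fun p : ℝ × ℝ => (-p.1, p.2)) :=
  ((MeasurableEquiv.neg ℝ).prodCongr (MeasurableEquiv.refl ℝ)).measurableEmbedding

theorem measurableEmbedding_neg_snd : MeasurableEmbedding (fun p : ℝ × ℝ => (p.1, -p.2)) :=
  ((MeasurableEquiv.refl ℝ).prodCongr (MeasurableEquiv.neg ℝ)).measurableEmbedding

theorem deriv_neg_eq_of_comp_neg {f : ℝ → ℝ} {c : ℝ} (h : ∀ t, f (-t) = c * f t) (a : ℝ) :
    deriv f (-a) = -(c * deriv f a) := by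
  have h' := deriv_comp_neg f a
  simp only [h, deriv_const_mul_field] at h'
  linarith

theorem grad3_neg_fst {v : ℝ → ℝ → ℝ → Fin 3 → ℝ} {s : Fin 3 → ℝ}
    (h : ∀ x1 x2 x3 k, v (-x1) x2 x3 k = s k * v x1 x2 x3 k) (x1 x2 x3 : ℝ) (k l : Fin 3) :
    grad3 v (-x1) x2 x3 k l = s k * ![-1, 1, 1] l * grad3 v x1 x2 x3 k l := by
  have hd := deriv_neg_eq_of_comp_neg (f := fun t => v t x2 x3 k) (fun t => h t x2 x3 k) x1
  fin_cases l <;> simp [grad3, h, deriv_const_mul_field, hd]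

theorem grad3_neg_snd {v : ℝ → ℝ → ℝ → Fin 3 → ℝ} {s : Fin 3 → ℝ}
    (h : ∀ x1 x2 x3 k, v x1 (-x2) x3 k = s k * v x1 x2 x3 k) (x1 x2 x3 : ℝ) (k l : Fin 3) :
    grad3 v x1 (-x2) x3 k l = s k * ![1, -1, 1] l * grad3 v x1 x2 x3 k l := by
  have hd := deriv_neg_eq_of_comp_neg (f := fun t => v x1 t x3 k) (fun t => h x1 t x3 k) x2
  fin_cases l <;> simp [grad3, h, deriv_const_mul_field, hd]

theorem ubar3_neg_fst (ε κ m U3 x1 x2 x3 : ℝ) (k : Fin 3) :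
    ubar3 ε κ m U3 (-x1) x2 x3 k = ![-1, 1, 1] k * ubar3 ε κ m U3 x1 x2 x3 k := by
  fin_cases k <;> simp [ubar3, δf, Kf, neg_div]

theorem ubar3_neg_snd (ε κ m U3 x1 x2 x3 : ℝ) (k : Fin 3) :
    ubar3 ε κ m U3 x1 (-x2) x3 k = ![1, -1, 1] k * ubar3 ε κ m U3 x1 x2 x3 k := by
  fin_cases k <;> simp [ubar3, δf, Kf, neg_div]

theorem sigma3_neg_fst (ε κ r m μ U3 x1 x2 x3 : ℝ) (k l : Fin 3) :
    sigma3 ε κ r m μ U3 (-x1) x2 x3 k l =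
      ![-1, 1, 1] k * ![-1, 1, 1] l * sigma3 ε κ r m μ U3 x1 x2 x3 k l := by
  have hp : pbar3 ε κ r m μ U3 (-x1) x2 x3 = pbar3 ε κ r m μ U3 x1 x2 x3 := by
    simp [pbar3, δf, Kf]
  simp only [sigma3, symGrad, Matrix.sub_apply, Matrix.smul_apply, Matrix.add_apply,
    Matrix.transpose_apply, grad3_neg_fst (ubar3_neg_fst ε κ m U3), hp, smul_eq_mul]
  fin_cases k <;> fin_cases l <;> simp <;> ring

theorem sigma3_neg_snd (ε κ r m μ U3 x1 x2 x3 : ℝ) (k l : Fin 3) :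
    sigma3 ε κ r m μ U3 x1 (-x2) x3 k l =
      ![1, -1, 1] k * ![1, -1, 1] l * sigma3 ε κ r m μ U3 x1 x2 x3 k l := by
  have hp : pbar3 ε κ r m μ U3 x1 (-x2) x3 = pbar3 ε κ r m μ U3 x1 x2 x3 := by
    simp [pbar3, δf, Kf]
  simp only [sigma3, symGrad, Matrix.sub_apply, Matrix.smul_apply, Matrix.add_apply,
    Matrix.transpose_apply, grad3_neg_snd (ubar3_neg_snd ε κ m U3), hp, smul_eq_mul]
  fin_cases k <;> fin_cases l <;> simp <;> ring

/-- By reflection symmetry in the two horizontal coordinates, the gap torque of the squeeze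
motion vanishes identically. -/
theorem squeeze_torque_eq_zero (ε κ r R m μ U3 : ℝ) :
    ∫ p in {q : ℝ × ℝ | Real.sqrt (q.1 ^ 2 + q.2 ^ 2) < r},
      crossProduct
        ![p.1, p.2, κ * Real.sqrt (p.1 ^ 2 + p.2 ^ 2) ^ m - R]
        ((sigma3 ε κ r m μ U3 p.1 p.2 (δf ε κ m p.1 p.2 / 2)).mulVec
          ![κ * m * Real.sqrt (p.1 ^ 2 + p.2 ^ 2) ^ (m - 2) * p.1,
            κ * m * Real.sqrt (p.1 ^ 2 + p.2 ^ 2) ^ (m - 2) * p.2, -1]) = 0 := by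
  by_cases hint : IntegrableOn (fun p : ℝ × ℝ => crossProduct
        ![p.1, p.2, κ * Real.sqrt (p.1 ^ 2 + p.2 ^ 2) ^ m - R]
        ((sigma3 ε κ r m μ U3 p.1 p.2 (δf ε κ m p.1 p.2 / 2)).mulVec
          ![κ * m * Real.sqrt (p.1 ^ 2 + p.2 ^ 2) ^ (m - 2) * p.1,
            κ * m * Real.sqrt (p.1 ^ 2 + p.2 ^ 2) ^ (m - 2) * p.2, -1]))
      {q : ℝ × ℝ | Real.sqrt (q.1 ^ 2 + q.2 ^ 2) < r}
  swap
  · exact integral_undef hint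
  have hδ₁ : ∀ x1 x2, δf ε κ m (-x1) x2 = δf ε κ m x1 x2 := by simp [δf]
  have hδ₂ : ∀ x1 x2, δf ε κ m x1 (-x2) = δf ε κ m x1 x2 := by simp [δf]
  ext i
  rw [eval_integral fun i => hint.eval i, Pi.zero_apply]
  fin_cases i
  · refine setIntegral_eq_zero_of_odd measurePreserving_neg_snd measurableEmbedding_neg_snd
      (by ext; simp) fun p => ?_
    simp [cross_apply, Matrix.mulVec, dotProduct, Fin.sum_univ_three, sigma3_neg_snd, hδ₂]
    ring
  · refine setIntegral_eq_zero_of_odd measurePreserving_neg_fst measurableEmbedding_neg_fst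
      (by ext; simp) fun p => ?_
    simp [cross_apply, Matrix.mulVec, dotProduct, Fin.sum_univ_three, sigma3_neg_fst, hδ₁]
    ring
  · refine setIntegral_eq_zero_of_odd measurePreserving_neg_fst measurableEmbedding_neg_fst
      (by ext; simp) fun p => ?_
    simp [cross_apply, Matrix.mulVec, dotProduct, Fin.sum_univ_three, sigma3_neg_fst, hδ₁]
    ring

/-- The approximate squeeze torque about `x_{D1}` from the gap stays bounded as
`ε → 0`:
`‖∫_{|x'|<r} (x₁,x₂,h−R) × [σ[ū⁽³⁾,p̄⁽³⁾](x',δ/2)·(∂₁h,∂₂h,−1)]dx'‖ ≤ C`. -/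
theorem stmt19 (κ r R m μ U3 : ℝ) (hκ : 0 < κ) (hr : 0 < r) (hR : 0 < R)
    (hm : 2 ≤ m) (hμ : 0 < μ) :
    ∃ C > 0, ∀ ε ∈ Set.Ioo (0 : ℝ) 1,
      enorm3
        (∫ p in {q : ℝ × ℝ | Real.sqrt (q.1 ^ 2 + q.2 ^ 2) < r},
          crossProduct
            ![p.1, p.2, κ * Real.sqrt (p.1 ^ 2 + p.2 ^ 2) ^ m - R]
            ((sigma3 ε κ r m μ U3 p.1 p.2 (δf ε κ m p.1 p.2 / 2)).mulVec
              ![κ * m * Real.sqrt (p.1 ^ 2 + p.2 ^ 2) ^ (m - 2) * p.1,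
                κ * m * Real.sqrt (p.1 ^ 2 + p.2 ^ 2) ^ (m - 2) * p.2, -1])) ≤ C := by
  refine ⟨1, one_pos, fun ε _ => ?_⟩
  rw [squeeze_torque_eq_zero]
  simp [enorm3]
end
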